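/- arXiv:1805.02636 — 4 statements merged into one kernel-verified Lean document; each statement's English description precedes it below -/
import Mathlib

section
/- Let τ₁, τ₂ > 0 and let P(m,n) = m·τ₁ + i·n·τ₂ ∈ ℂ for integers m, n, with rectangular lattice Λ = {P(m,n) : m, n ∈ ℤ}. Then for every z ∈ ℂ ∖ Λ, the family (m,n) ↦ 1/(z − P(m,n)) + 1/P(m,n) + z/P(m,n)², indexed by (m,n) ∈ ℤ² ∖ {(0,0)}, is summable in ℂ. -/
/-- The point `P(m,n) = m·τ₁ + i·n·τ₂` of the rectangular lattice. -/
noncomputable def latP (τ₁ τ₂ : ℝ) (p : ℤ × ℤ) : ℂ :=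
  (p.1 : ℂ) * τ₁ + Complex.I * (p.2 : ℂ) * τ₂

/-- The rectangular lattice `Λ = {m·τ₁ + i·n·τ₂ : m, n ∈ ℤ}`. -/
noncomputable def lattice (τ₁ τ₂ : ℝ) : Set ℂ := Set.range (latP τ₁ τ₂)

theorem mul_norm_le_norm_latP {τ₁ τ₂ c : ℝ} (hc : 0 ≤ c) (h₁ : c ≤ τ₁) (h₂ : c ≤ τ₂)
    (p : ℤ × ℤ) : c * ‖p‖ ≤ ‖latP τ₁ τ₂ p‖ := by
  have hre : (latP τ₁ τ₂ p).re = p.1 * τ₁ := by simp [latP]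
  have him : (latP τ₁ τ₂ p).im = p.2 * τ₂ := by simp [latP]
  rw [Prod.norm_def, mul_max_of_nonneg _ _ hc, Int.norm_eq_abs, Int.norm_eq_abs]
  refine max_le ?_ ?_
  · refine le_trans ?_ (Complex.abs_re_le_norm _)
    rw [hre, abs_mul, abs_of_nonneg (hc.trans h₁), mul_comm]
    gcongr
  · refine le_trans ?_ (Complex.abs_im_le_norm _)
    rw [him, abs_mul, abs_of_nonneg (hc.trans h₂), mul_comm]
    gcongr

theorem summable_inv_norm_pow_int_prod {k : ℕ} (hk : 2 < k) :
    Summable fun p : ℤ × ℤ => (‖p‖ ^ k)⁻¹ := by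
  rw [← (finTwoArrowEquiv ℤ).summable_iff]
  refine (EisensteinSeries.summable_one_div_norm_rpow (k := k) (by exact_mod_cast hk)).congr
    fun x => ?_
  have hx : ‖finTwoArrowEquiv ℤ x‖ = ‖x‖ := by
    rw [EisensteinSeries.norm_eq_max_natAbs, Prod.norm_def, Int.norm_eq_abs, Int.norm_eq_abs]
    simp [Nat.cast_natAbs]
  rw [Real.rpow_neg (norm_nonneg _), Real.rpow_natCast, Function.comp_apply, hx]

theorem norm_zeta_summand_le {z w : ℂ} (hw : w ≠ 0) (hzw : 2 * ‖z‖ ≤ ‖w‖) :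
    ‖1 / (z - w) + 1 / w + z / w ^ 2‖ ≤ 2 * ‖z‖ ^ 2 * (‖w‖ ^ 3)⁻¹ := by
  have hw' : 0 < ‖w‖ := norm_pos_iff.mpr hw
  have hd : ‖w‖ / 2 ≤ ‖z - w‖ := by
    have := norm_sub_norm_le w z
    rw [norm_sub_rev] at this
    linarith
  have hne : z - w ≠ 0 := norm_pos_iff.mp (by linarith)
  have key : 1 / (z - w) + 1 / w + z / w ^ 2 = z ^ 2 / (w ^ 2 * (z - w)) := by
    field_simp
    ring
  rw [key, norm_div, norm_mul, norm_pow, norm_pow]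
  calc ‖z‖ ^ 2 / (‖w‖ ^ 2 * ‖z - w‖) ≤ ‖z‖ ^ 2 / (‖w‖ ^ 2 * (‖w‖ / 2)) := by gcongr
    _ = 2 * ‖z‖ ^ 2 * (‖w‖ ^ 3)⁻¹ := by field_simp

/-- The defining series of the Weierstrass zeta function of the rectangular
lattice is (absolutely) summable at every point off the lattice. -/
theorem weierstrass_zeta_summands_summable (τ₁ τ₂ : ℝ) (hτ₁ : 0 < τ₁) (hτ₂ : 0 < τ₂)
    (z : ℂ) (hz : z ∉ lattice τ₁ τ₂) :
    Summable (fun p : {p : ℤ × ℤ // p ≠ (0, 0)} =>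
      1 / (z - latP τ₁ τ₂ p.1) + 1 / latP τ₁ τ₂ p.1 + z / (latP τ₁ τ₂ p.1) ^ 2) := by
  obtain ⟨c, hc, h₁, h₂⟩ : ∃ c : ℝ, 0 < c ∧ c ≤ τ₁ ∧ c ≤ τ₂ :=
    ⟨min τ₁ τ₂, lt_min hτ₁ hτ₂, min_le_left _ _, min_le_right _ _⟩
  have hbound := mul_norm_le_norm_latP hc.le h₁ h₂
  have hlarge : ∀ᶠ p : ℤ × ℤ in Filter.cofinite, 2 * ‖z‖ / c ≤ ‖p‖ := by
    rw [← Filter.cocompact_eq_cofinite]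
    exact (tendsto_norm_cocompact_atTop (E := ℤ × ℤ)).eventually_ge_atTop _
  have hsum : Summable fun p : {p : ℤ × ℤ // p ≠ (0, 0)} =>
      2 * ‖z‖ ^ 2 * (c ^ 3)⁻¹ * (‖p.1‖ ^ 3)⁻¹ :=
    ((summable_inv_norm_pow_int_prod (by norm_num : 2 < 3)).comp_injective
      Subtype.val_injective).mul_left _
  refine hsum.of_norm_bounded_eventually ?_
  filter_upwards [Subtype.val_injective.tendsto_cofinite.eventually hlarge] with p hp
  have hpos : 0 < ‖p.1‖ := norm_pos_iff.mpr p.2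
  have hP : 0 < ‖latP τ₁ τ₂ p.1‖ := (mul_pos hc hpos).trans_le (hbound p.1)
  have hzP : 2 * ‖z‖ ≤ ‖latP τ₁ τ₂ p.1‖ := ((div_le_iff₀' hc).mp hp).trans (hbound p.1)
  calc _ ≤ 2 * ‖z‖ ^ 2 * (‖latP τ₁ τ₂ p.1‖ ^ 3)⁻¹ :=
        norm_zeta_summand_le (norm_pos_iff.mp hP) hzP
    _ ≤ 2 * ‖z‖ ^ 2 * ((c * ‖p.1‖) ^ 3)⁻¹ := by
        gcongr
        exact hbound p.1
    _ = 2 * ‖z‖ ^ 2 * (c ^ 3)⁻¹ * (‖p.1‖ ^ 3)⁻¹ := by rw [mul_pow, mul_inv, mul_assoc _ (c ^ 3)⁻¹]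
end

section
/- Let τ₁, τ₂ > 0, let Λ be the rectangular lattice with periods τ₁ and i·τ₂, and let ζ be the Weierstrass zeta function of Λ. Then for every a with 0 < a < min(τ₁, τ₂), the contour integral of ζ(z) against dz̄ over the circle |z| = a vanishes: ∫_0^{2π} ζ(a·e^{iθ}) · (−i·a·e^{−iθ}) dθ = 0. -/
/-- The Weierstrass zeta function of the rectangular lattice with periods
`τ₁` and `i·τ₂`:
`ζ(z) = 1/z + Σ'_{(m,n)≠(0,0)} [1/(z−P(m,n)) + 1/P(m,n) + z/P(m,n)²]`. -/
noncomputable def wzeta (τ₁ τ₂ : ℝ) (z : ℂ) : ℂ :=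
  1 / z + ∑' p : {p : ℤ × ℤ // p ≠ (0, 0)},
    (1 / (z - latP τ₁ τ₂ p.1) + 1 / latP τ₁ τ₂ p.1 + z / (latP τ₁ τ₂ p.1) ^ 2)

/-- The summand of the Weierstrass zeta function attached to the lattice point `w`. -/
noncomputable def wzetaSummand (w z : ℂ) : ℂ :=
  1 / (z - w) + 1 / w + z / w ^ 2

theorem wzetaSummand_eq {w z : ℂ} (hw : w ≠ 0) (hzw : z - w ≠ 0) :
    wzetaSummand w z = z ^ 2 / (w ^ 2 * (z - w)) := by
  unfold wzetaSummand
  field_simp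
  ring

theorem min_mul_norm_le_norm_latP {τ₁ τ₂ : ℝ} (hτ₁ : 0 < τ₁) (hτ₂ : 0 < τ₂) (p : ℤ × ℤ) :
    min τ₁ τ₂ * ‖p‖ ≤ ‖latP τ₁ τ₂ p‖ := by
  have hre : (latP τ₁ τ₂ p).re = p.1 * τ₁ := by simp [latP]
  have him : (latP τ₁ τ₂ p).im = p.2 * τ₂ := by simp [latP]
  rw [Prod.norm_def, mul_max_of_nonneg _ _ (le_min hτ₁.le hτ₂.le), Int.norm_eq_abs,
    Int.norm_eq_abs]
  refine max_le ?_ ?_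
  · calc min τ₁ τ₂ * |(p.1 : ℝ)| ≤ τ₁ * |(p.1 : ℝ)| := by gcongr; exact min_le_left _ _
      _ = |(latP τ₁ τ₂ p).re| := by rw [hre, abs_mul, abs_of_pos hτ₁, mul_comm]
      _ ≤ _ := Complex.abs_re_le_norm _
  · calc min τ₁ τ₂ * |(p.2 : ℝ)| ≤ τ₂ * |(p.2 : ℝ)| := by gcongr; exact min_le_right _ _
      _ = |(latP τ₁ τ₂ p).im| := by rw [him, abs_mul, abs_of_pos hτ₂, mul_comm]
      _ ≤ _ := Complex.abs_im_le_norm _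

theorem one_le_norm_of_ne_zero {p : ℤ × ℤ} (hp : p ≠ 0) : 1 ≤ ‖p‖ := by
  rw [Prod.norm_def, le_max_iff, Int.norm_eq_abs, Int.norm_eq_abs]
  have h : p.1 ≠ 0 ∨ p.2 ≠ 0 := by
    by_contra! h
    exact hp (Prod.ext h.1 h.2)
  exact h.imp (fun h ↦ mod_cast Int.one_le_abs h) (fun h ↦ mod_cast Int.one_le_abs h)

theorem summable_inv_norm_pow_three : Summable fun p : ℤ × ℤ ↦ (‖p‖ ^ 3)⁻¹ := by
  have h := EisensteinSeries.summable_one_div_norm_rpow (k := 3) (by norm_num)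
  rw [← (finTwoArrowEquiv ℤ).symm.summable_iff] at h
  refine h.congr fun p ↦ ?_
  have hp : ‖(finTwoArrowEquiv ℤ).symm p‖ = ‖p‖ := by
    simp [EisensteinSeries.norm_eq_max_natAbs, Prod.norm_def, Int.norm_eq_abs,
      Nat.cast_natAbs]
  rw [Function.comp_apply, hp, Real.rpow_neg (norm_nonneg _)]
  norm_cast

theorem norm_wzetaSummand_le {w z : ℂ} {r n : ℝ} (hz : ‖z‖ < r) (hn : 1 ≤ n)
    (hw : r * n ≤ ‖w‖) :
    ‖wzetaSummand w z‖ ≤ ‖z‖ ^ 2 / (r ^ 2 * (r - ‖z‖)) * (n ^ 3)⁻¹ := by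
  have hr : 0 < r := (norm_nonneg z).trans_lt hz
  have hrz : 0 < r - ‖z‖ := sub_pos.2 hz
  have hdist : (r - ‖z‖) * n ≤ ‖z - w‖ := by
    have := norm_sub_norm_le w z
    rw [norm_sub_rev] at this
    nlinarith [norm_nonneg z]
  have hw0 : w ≠ 0 := norm_pos_iff.1 (lt_of_lt_of_le (by positivity) hw)
  have hzw : z - w ≠ 0 := norm_pos_iff.1 (lt_of_lt_of_le (by positivity) hdist)
  rw [wzetaSummand_eq hw0 hzw, norm_div, norm_mul, norm_pow, norm_pow]
  calc ‖z‖ ^ 2 / (‖w‖ ^ 2 * ‖z - w‖)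
      ≤ ‖z‖ ^ 2 / ((r * n) ^ 2 * ((r - ‖z‖) * n)) := by gcongr
    _ = _ := by field_simp

theorem circle_param_integral_wzetaSummand {a : ℝ} (ha : 0 < a) {w : ℂ} (hw : a < ‖w‖) :
    ∫ θ in (0 : ℝ)..(2 * Real.pi),
      wzetaSummand w (a * Complex.exp (Complex.I * θ)) *
        (-Complex.I * a * Complex.exp (-Complex.I * θ)) = 0 := by
  have hne : ∀ z ∈ Metric.closedBall (0 : ℂ) a, z - w ≠ 0 := by
    rintro z hz h
    rw [sub_eq_zero.1 h, mem_closedBall_zero_iff] at hz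
    exact hw.not_ge hz
  have hdiff : DifferentiableOn ℂ (fun z ↦ -(a : ℂ) ^ 2 / (w ^ 2 * (z - w)))
      (Metric.closedBall 0 a) := by
    have hw0 : w ≠ 0 := norm_pos_iff.1 (ha.trans hw)
    refine (differentiableOn_const _).div (by fun_prop) fun z hz ↦ ?_
    exact mul_ne_zero (pow_ne_zero 2 hw0) (hne z hz)
  have h := (hdiff.diffContOnCl_ball subset_rfl).circleIntegral_eq_zero ha.le
  rw [circleIntegral] at h
  rw [← h]
  refine intervalIntegral.integral_congr fun θ _ ↦ ?_
  have hz : circleMap 0 a θ = a * Complex.exp (Complex.I * θ) := by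
    rw [circleMap_zero, mul_comm (θ : ℂ)]
  have hmem := hne _ (circleMap_mem_closedBall 0 ha.le θ)
  have hw0 : w ≠ 0 := norm_pos_iff.1 (ha.trans hw)
  simp only [deriv_circleMap, smul_eq_mul]
  rw [hz] at hmem ⊢
  rw [wzetaSummand_eq hw0 hmem, neg_mul Complex.I (θ : ℂ), Complex.exp_neg]
  have := Complex.exp_ne_zero (Complex.I * θ)
  field_simp

theorem circle_param_integral_inv {a : ℝ} (ha : 0 < a) :
    ∫ θ in (0 : ℝ)..(2 * Real.pi),
      1 / (a * Complex.exp (Complex.I * θ)) *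
        (-Complex.I * a * Complex.exp (-Complex.I * θ)) = 0 := by
  have ha0 : (a : ℂ) ≠ 0 := mod_cast ha.ne'
  have hint : ∀ θ : ℝ, 1 / (a * Complex.exp (Complex.I * θ)) *
      (-Complex.I * a * Complex.exp (-Complex.I * θ)) =
        -Complex.I * Complex.exp (-2 * Complex.I * θ) := by
    intro θ
    have h2 : -2 * Complex.I * θ = -(Complex.I * θ) + -(Complex.I * θ) := by ring
    rw [h2, Complex.exp_add, neg_mul Complex.I (θ : ℂ), Complex.exp_neg]
    have := Complex.exp_ne_zero (Complex.I * θ)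
    field_simp
  simp_rw [hint]
  rw [intervalIntegral.integral_const_mul,
    integral_exp_mul_complex (mul_ne_zero (by norm_num) Complex.I_ne_zero)]
  have hperiod : Complex.exp (-2 * Complex.I * (2 * Real.pi : ℝ)) = 1 := by
    rw [Complex.exp_eq_one_iff]
    exact ⟨-2, by push_cast; ring⟩
  rw [hperiod]
  simp

/-- The contour integral `∮_{|z|=a} ζ(z) dz̄` over a circle of radius
`a < min(τ₁,τ₂)` centered at the origin vanishes. -/
theorem contour_integral_wzeta_dzbar (τ₁ τ₂ : ℝ) (hτ₁ : 0 < τ₁) (hτ₂ : 0 < τ₂)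
    (a : ℝ) (ha : 0 < a) (ha' : a < min τ₁ τ₂) :
    ∫ θ in (0:ℝ)..(2 * Real.pi),
      wzeta τ₁ τ₂ (a * Complex.exp (Complex.I * θ)) *
        (-Complex.I * a * Complex.exp (-Complex.I * θ)) = 0 := by
  set r := min τ₁ τ₂ with hr
  have hr0 : 0 < r := ha.trans ha'
  have hexp : ∀ θ : ℝ, ‖Complex.exp (Complex.I * θ)‖ = 1 := fun θ ↦ by
    rw [mul_comm, Complex.norm_exp_ofReal_mul_I]
  have hznorm : ∀ θ : ℝ, ‖(a : ℂ) * Complex.exp (Complex.I * θ)‖ = a := fun θ ↦ by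
    rw [norm_mul, hexp, mul_one, Complex.norm_real, Real.norm_of_nonneg ha.le]
  have hdznorm : ∀ θ : ℝ, ‖-Complex.I * a * Complex.exp (-Complex.I * θ)‖ = a := fun θ ↦ by
    rw [neg_mul Complex.I (θ : ℂ), Complex.exp_neg, norm_mul, norm_inv, hexp]
    simp [abs_of_pos ha]
  let ι := {p : ℤ × ℤ // p ≠ (0, 0)}
  have hone : ∀ p : ι, 1 ≤ ‖p.1‖ := fun p ↦ one_le_norm_of_ne_zero p.2
  have hlat : ∀ p : ι, r * ‖p.1‖ ≤ ‖latP τ₁ τ₂ p.1‖ := fun p ↦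
    min_mul_norm_le_norm_latP hτ₁ hτ₂ p.1
  have hlt : ∀ p : ι, a < ‖latP τ₁ τ₂ p.1‖ := fun p ↦
    (ha'.trans_le (le_mul_of_one_le_right hr0.le (hone p))).trans_le (hlat p)
  let u : ι → ℝ := fun p ↦ a ^ 2 / (r ^ 2 * (r - a)) * (‖p.1‖ ^ 3)⁻¹
  have hu : Summable u := (summable_inv_norm_pow_three.subtype _).mul_left _
  let f : ι → ℝ → ℂ := fun p θ ↦
    wzetaSummand (latP τ₁ τ₂ p.1) (a * Complex.exp (Complex.I * θ))
  have hfu : ∀ p θ, ‖f p θ‖ ≤ u p := fun p θ ↦ by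
    have h := norm_wzetaSummand_le ((hznorm θ).trans_lt ha') (hone p) (hlat p)
    rwa [hznorm] at h
  have hfc : ∀ p, Continuous (f p) := fun p ↦ by
    have hne : ∀ θ : ℝ, a * Complex.exp (Complex.I * θ) - latP τ₁ τ₂ p.1 ≠ 0 := fun θ h ↦
      (hlt p).ne' (by rw [← sub_eq_zero.1 h, hznorm])
    simp only [f, wzetaSummand]
    fun_prop (disch := exact hne _)
  have hsum : Continuous fun θ ↦ ∑' p, f p θ := continuous_tsum hfc hu hfu
  have hdz : Continuous fun θ : ℝ ↦ -Complex.I * a * Complex.exp (-Complex.I * θ) := by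
    fun_prop
  have hinv : Continuous fun θ : ℝ ↦ 1 / ((a : ℂ) * Complex.exp (Complex.I * θ)) := by
    have hne : ∀ θ : ℝ, (a : ℂ) * Complex.exp (Complex.I * θ) ≠ 0 := fun θ ↦
      norm_pos_iff.1 ((hznorm θ).symm ▸ ha)
    fun_prop (disch := exact hne _)
  have htsum : ∫ θ in (0 : ℝ)..(2 * Real.pi),
      (∑' p, f p θ) * (-Complex.I * a * Complex.exp (-Complex.I * θ)) = 0 := by
    have h := intervalIntegral.hasSum_integral_of_dominated_convergence
      (μ := MeasureTheory.volume) (a := 0) (b := 2 * Real.pi)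
      (F := fun p θ ↦ f p θ * (-Complex.I * a * Complex.exp (-Complex.I * θ)))
      (f := fun θ ↦ (∑' p, f p θ) * (-Complex.I * a * Complex.exp (-Complex.I * θ)))
      (fun p _ ↦ u p * a)
      (fun p ↦ ((hfc p).mul hdz).aestronglyMeasurable)
      (fun p ↦ .of_forall fun θ _ ↦ by
        rw [norm_mul, hdznorm]
        exact mul_le_mul_of_nonneg_right (hfu p θ) ha.le)
      (.of_forall fun θ _ ↦ hu.mul_right a)
      intervalIntegrable_const
      (.of_forall fun θ _ ↦
        (Summable.of_norm_bounded hu fun p ↦ hfu p θ).hasSum.mul_right _)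
    refine h.unique ?_
    convert hasSum_zero with p
    exact circle_param_integral_wzetaSummand ha (hlt p)
  calc ∫ θ in (0:ℝ)..(2 * Real.pi), wzeta τ₁ τ₂ (a * Complex.exp (Complex.I * θ)) *
        (-Complex.I * a * Complex.exp (-Complex.I * θ))
      = ∫ θ in (0:ℝ)..(2 * Real.pi), (1 / (a * Complex.exp (Complex.I * θ)) *
          (-Complex.I * a * Complex.exp (-Complex.I * θ)) +
        (∑' p, f p θ) * (-Complex.I * a * Complex.exp (-Complex.I * θ))) := by
        refine intervalIntegral.integral_congr fun θ _ ↦ ?_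
        exact add_mul _ _ _
    _ = 0 := by
        rw [intervalIntegral.integral_add ((hinv.fun_mul hdz).intervalIntegrable _ _)
          ((hsum.fun_mul hdz).intervalIntegrable _ _), circle_param_integral_inv ha, htsum,
          add_zero]
end

section
/- Let q ∈ ℝ² and λ ∈ ℂ, and let u : ℝ² → ℂ be a transmission function (with C² pieces U_in on a neighborhood of the closed disks and U_ex on a neighborhood of the complement of the open disks) which satisfies the Floquet condition u(r + τ) = e^{i q·τ} · u(r) for τ = (τ₁, 0) and τ = (0, τ₂) and all r ∈ ℝ², and the Helmholtz equations −ΔU_in = λ·ε·U_in on D and −ΔU_ex = λ·U_ex on ℝ² ∖ closure(D). Then Green's identity holds: ∫_S (1/ε̃(r))·(|∂ₓu(r)|² + |∂ᵧu(r)|²) dr = λ · ∫_S |u(r)|² dr. -/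
open MeasureTheory Set
open scoped Classical

/-- The lattice `L = {(m·τ₁, n·τ₂) : m, n ∈ ℤ}` of centers in `ℝ²`. -/
def centers (τ₁ τ₂ : ℝ) : Set (ℝ × ℝ) := {p | ∃ m n : ℤ, p = (m * τ₁, n * τ₂)}

/-- `D`: the union of the open Euclidean disks of radius `a` centered at the
lattice points. -/
def disks (τ₁ τ₂ a : ℝ) : Set (ℝ × ℝ) :=
  {q | ∃ p ∈ centers τ₁ τ₂, (q.1 - p.1) ^ 2 + (q.2 - p.2) ^ 2 < a ^ 2}

/-- The piecewise dielectric constant `ε̃`, equal to `ε` on `D` and `1` elsewhere. -/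
noncomputable def epsTilde (τ₁ τ₂ a ε : ℝ) (q : ℝ × ℝ) : ℝ :=
  if q ∈ disks τ₁ τ₂ a then ε else 1

/-- The fundamental cell `S = [−τ₁/2, τ₁/2] × [−τ₂/2, τ₂/2]`. -/
def cell (τ₁ τ₂ : ℝ) : Set (ℝ × ℝ) :=
  Icc (-τ₁ / 2) (τ₁ / 2) ×ˢ Icc (-τ₂ / 2) (τ₂ / 2)

/-- The Laplacian `Δf = ∂²f/∂x² + ∂²f/∂y²` of `f : ℝ² → ℂ`. -/
noncomputable def lap (f : ℝ × ℝ → ℂ) (q : ℝ × ℝ) : ℂ :=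
  fderiv ℝ (fun p => fderiv ℝ f p (1, 0)) q (1, 0) +
    fderiv ℝ (fun p => fderiv ℝ f p (0, 1)) q (0, 1)

/-- `u` is a transmission function with pieces `Uin`, `Uex`: `Uin` is `C²` on a
neighborhood of the closed disks, `Uex` is `C²` on a neighborhood of the
complement of the open disks, `u` is glued from them, the pieces agree on the
circles, and the normal (radial) derivatives satisfy
`(1/ε)·∂Uin/∂n = ∂Uex/∂n` there. -/
structure IsTransmission (τ₁ τ₂ a ε : ℝ) (u Uin Uex : ℝ × ℝ → ℂ) : Prop where
  smooth_in : ∃ N : Set (ℝ × ℝ), IsOpen N ∧ closure (disks τ₁ τ₂ a) ⊆ N ∧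
    ContDiffOn ℝ 2 Uin N
  smooth_ex : ∃ N : Set (ℝ × ℝ), IsOpen N ∧ (disks τ₁ τ₂ a)ᶜ ⊆ N ∧
    ContDiffOn ℝ 2 Uex N
  eq_in : ∀ q ∈ disks τ₁ τ₂ a, u q = Uin q
  eq_ex : ∀ q ∉ disks τ₁ τ₂ a, u q = Uex q
  continuity : ∀ p ∈ centers τ₁ τ₂, ∀ q : ℝ × ℝ,
    (q.1 - p.1) ^ 2 + (q.2 - p.2) ^ 2 = a ^ 2 → Uin q = Uex q
  flux : ∀ p ∈ centers τ₁ τ₂, ∀ q : ℝ × ℝ,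
    (q.1 - p.1) ^ 2 + (q.2 - p.2) ^ 2 = a ^ 2 →
      (1 / ε : ℂ) * fderiv ℝ Uin q (q.1 - p.1, q.2 - p.2) =
        fderiv ℝ Uex q (q.1 - p.1, q.2 - p.2)

open Filter Topology
open scoped Manifold ContDiff

/-- A function that is `C^n` on an open set agrees near any closed subset with a globally `C^n`
function. -/
lemma exists_contDiff_eventuallyEq_of_isClosed {E : Type*} [NormedAddCommGroup E]
    [NormedSpace ℝ E] [FiniteDimensional ℝ E] {F : Type*} [NormedAddCommGroup F] [NormedSpace ℝ F]
    {n : ℕ∞} {C N : Set E} (hC : IsClosed C) (hN : IsOpen N) (hCN : C ⊆ N) {f : E → F}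
    (hf : ContDiffOn ℝ n f N) :
    ∃ g : E → F, ContDiff ℝ n g ∧ ∀ p ∈ C, g =ᶠ[𝓝 p] f := by
  obtain ⟨φ, h0, h1, -⟩ := exists_contMDiffMap_zero_one_nhds_of_isClosed (n := n) 𝓘(ℝ, E)
    hN.isClosed_compl hC (disjoint_compl_left_iff_subset.2 hCN)
  have hφ : ContDiff ℝ n φ := φ.contMDiff.contDiff
  rw [eventually_nhdsSet_iff_forall] at h0 h1
  refine ⟨fun x => φ x • f x, contDiff_iff_contDiffAt.2 fun x => ?_, fun p hp => ?_⟩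
  · by_cases hx : x ∈ N
    · exact hφ.contDiffAt.smul (hf.contDiffAt (hN.mem_nhds hx))
    · refine (contDiffAt_const (c := (0 : F))).congr_of_eventuallyEq ?_
      filter_upwards [h0 x hx] with y hy
      simp [hy]
  · filter_upwards [h1 p hp] with y hy
    simp [hy]

/-- The divergence of the planar vector field with components `F` and `G`. -/
noncomputable def planeDiv (F G : ℝ × ℝ → ℂ) (p : ℝ × ℝ) : ℂ :=
  fderiv ℝ F p (1, 0) + fderiv ℝ G p (0, 1)

/-- The open disk of radius `a` centered at the origin. -/
def openDisk (a : ℝ) : Set (ℝ × ℝ) := {q | q.1 ^ 2 + q.2 ^ 2 < a ^ 2}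

/-- The closed disk of radius `a` centered at the origin. -/
def closedDisk (a : ℝ) : Set (ℝ × ℝ) := {q | q.1 ^ 2 + q.2 ^ 2 ≤ a ^ 2}

lemma mem_openDisk {a : ℝ} {q : ℝ × ℝ} : q ∈ openDisk a ↔ q.1 ^ 2 + q.2 ^ 2 < a ^ 2 := by
  simp [openDisk]

lemma mem_closedDisk {a : ℝ} {q : ℝ × ℝ} : q ∈ closedDisk a ↔ q.1 ^ 2 + q.2 ^ 2 ≤ a ^ 2 := by
  simp [closedDisk]

lemma isOpen_openDisk (a : ℝ) : IsOpen (openDisk a) :=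
  isOpen_lt (by fun_prop) continuous_const

lemma isClosed_closedDisk (a : ℝ) : IsClosed (closedDisk a) :=
  isClosed_le (by fun_prop) continuous_const

lemma openDisk_subset_closedDisk (a : ℝ) : openDisk a ⊆ closedDisk a :=
  fun _ h => mem_closedDisk.2 (mem_openDisk.1 h).le

lemma closedDisk_subset_Icc {a : ℝ} (ha : 0 ≤ a) : closedDisk a ⊆ Icc (-a, -a) (a, a) := by
  rintro ⟨x, y⟩ h
  simp only [mem_closedDisk] at h
  exact ⟨⟨by nlinarith, by nlinarith⟩, ⟨by nlinarith, by nlinarith⟩⟩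

lemma isCompact_closedDisk {a : ℝ} (ha : 0 ≤ a) : IsCompact (closedDisk a) :=
  isCompact_Icc.of_isClosed_subset (isClosed_closedDisk a) (closedDisk_subset_Icc ha)

lemma convex_closedDisk (a : ℝ) : Convex ℝ (closedDisk a) := by
  rintro ⟨x, y⟩ h ⟨z, w⟩ h' s t hs ht hst
  simp only [mem_closedDisk, Prod.smul_mk, Prod.mk_add_mk, smul_eq_mul] at h h' ⊢
  obtain rfl : t = 1 - s := by linarith
  nlinarith [mul_nonneg hs ht, mul_nonneg (mul_nonneg hs ht) (sq_nonneg (x - z)),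
    mul_nonneg (mul_nonneg hs ht) (sq_nonneg (y - w)), mul_nonneg hs (sub_nonneg.2 h),
    mul_nonneg ht (sub_nonneg.2 h')]

lemma closedDisk_subset_closure_openDisk {a : ℝ} (ha : 0 < a) :
    closedDisk a ⊆ closure (openDisk a) := by
  intro q hq
  have hlim : Tendsto (fun t : ℝ => t • q) (𝓝[<] 1) (𝓝 q) := by
    have : Tendsto (fun t : ℝ => t • q) (𝓝 1) (𝓝 ((1 : ℝ) • q)) :=
      (continuous_id.smul continuous_const).tendsto 1
    rw [one_smul] at this
    exact this.mono_left nhdsWithin_le_nhds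
  refine mem_closure_of_tendsto hlim ?_
  filter_upwards [Ioo_mem_nhdsLT (zero_lt_one (α := ℝ))] with t ht
  simp only [mem_closedDisk, mem_openDisk, Prod.smul_fst, Prod.smul_snd, smul_eq_mul] at hq ⊢
  have : t ^ 2 < 1 := by nlinarith [ht.1, ht.2]
  nlinarith [sq_nonneg t, pow_pos ha 2, mul_le_mul_of_nonneg_left hq (sq_nonneg t),
    mul_lt_mul_of_pos_right this (pow_pos ha 2)]

lemma volume_closedDisk_diff_openDisk {a : ℝ} (ha : 0 < a) :
    volume (closedDisk a \ openDisk a) = 0 := by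
  refine measure_mono_null ?_ ((convex_closedDisk a).addHaar_frontier volume)
  rintro q ⟨hq, hq'⟩
  refine ⟨subset_closure hq, fun hint => hq' ?_⟩
  have hlim : Tendsto (fun t : ℝ => t • q) (𝓝[>] 1) (𝓝 q) := by
    have : Tendsto (fun t : ℝ => t • q) (𝓝 1) (𝓝 ((1 : ℝ) • q)) :=
      (continuous_id.smul continuous_const).tendsto 1
    rw [one_smul] at this
    exact this.mono_left nhdsWithin_le_nhds
  obtain ⟨t, ht, ht1⟩ := ((hlim.eventually (mem_interior_iff_mem_nhds.1 hint)).and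
    self_mem_nhdsWithin).exists
  simp only [Prod.smul_fst, Prod.smul_snd, smul_eq_mul] at ht
  rw [mem_openDisk]
  have h1 : 1 < t ^ 2 := by nlinarith
  have h2 : t ^ 2 * (q.1 ^ 2 + q.2 ^ 2) ≤ a ^ 2 := by linarith [mul_pow t q.1 2, mul_pow t q.2 2]
  by_contra h3
  push Not at h3
  nlinarith [pow_pos ha 2]

lemma continuous_fderiv_apply_of_contDiff {F : ℝ × ℝ → ℂ} (hF : ContDiff ℝ 1 F) (v : ℝ × ℝ) :
    Continuous fun p => fderiv ℝ F p v :=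
  (hF.continuous_fderiv one_ne_zero).clm_apply continuous_const

lemma continuous_planeDiv {F G : ℝ × ℝ → ℂ} (hF : ContDiff ℝ 1 F) (hG : ContDiff ℝ 1 G) :
    Continuous (planeDiv F G) :=
  (continuous_fderiv_apply_of_contDiff hF _).add (continuous_fderiv_apply_of_contDiff hG _)

lemma integral_planeDiv_Icc {F G : ℝ × ℝ → ℂ} (hF : ContDiff ℝ 1 F) (hG : ContDiff ℝ 1 G)
    {a b : ℝ × ℝ} (hab : a ≤ b) :
    ∫ p in Icc a b, planeDiv F G p =
      (((∫ x in a.1..b.1, G (x, b.2)) - ∫ x in a.1..b.1, G (x, a.2)) +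
          ∫ y in a.2..b.2, F (b.1, y)) - ∫ y in a.2..b.2, F (a.1, y) :=
  integral_divergence_prod_Icc_of_hasFDerivAt_of_le F G (fderiv ℝ F) (fderiv ℝ G) a b hab
    hF.continuous.continuousOn hG.continuous.continuousOn
    (fun p _ => (hF.differentiable one_ne_zero p).hasFDerivAt)
    (fun p _ => (hG.differentiable one_ne_zero p).hasFDerivAt)
    ((continuous_planeDiv hF hG).continuousOn.integrableOn_compact isCompact_Icc)

lemma deriv_smoothTransition_of_nonpos {s : ℝ} (hs : s ≤ 0) :
    deriv Real.smoothTransition s = 0 := by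
  refine IsLocalMin.deriv_eq_zero (Eventually.of_forall fun t => ?_)
  rw [Real.smoothTransition.zero_of_nonpos hs]
  exact Real.smoothTransition.nonneg t

lemma deriv_smoothTransition_of_one_le {s : ℝ} (hs : 1 ≤ s) :
    deriv Real.smoothTransition s = 0 := by
  refine IsLocalMax.deriv_eq_zero (Eventually.of_forall fun t => ?_)
  rw [Real.smoothTransition.one_of_one_le hs]
  exact Real.smoothTransition.le_one t

lemma exists_bound_deriv_smoothTransition :
    ∃ M : ℝ, 0 ≤ M ∧ ∀ s, |deriv Real.smoothTransition s| ≤ M := by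
  have hc : Continuous (deriv Real.smoothTransition) :=
    (Real.smoothTransition.contDiff (n := 1)).continuous_deriv le_rfl
  obtain ⟨M, hM⟩ := isCompact_Icc.exists_bound_of_continuousOn (s := Icc (0 : ℝ) 1) hc.continuousOn
  have hM0 : 0 ≤ M := (norm_nonneg _).trans (hM 0 (by simp))
  refine ⟨M, hM0, fun s => ?_⟩
  rcases le_or_gt s 0 with h | h
  · simpa [deriv_smoothTransition_of_nonpos h]
  rcases le_or_gt 1 s with h' | h'
  · simpa [deriv_smoothTransition_of_one_le h']
  exact hM s ⟨h.le, h'.le⟩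

/-- A `C¹` function on the plane which vanishes on a circle around the origin and at the origin is
controlled inside the circle by the defining function of the disk. -/
lemma exists_bound_of_eq_zero_on_circle {a : ℝ} (ha : 0 < a) {h : ℝ × ℝ → ℂ}
    (hh : ContDiff ℝ 1 h) (h0 : h 0 = 0) (hz : ∀ q : ℝ × ℝ, q.1 ^ 2 + q.2 ^ 2 = a ^ 2 → h q = 0) :
    ∃ L : ℝ, 0 ≤ L ∧ ∀ q ∈ openDisk a, ‖h q‖ ≤ L * (a ^ 2 - (q.1 ^ 2 + q.2 ^ 2)) := by
  obtain ⟨L, hL⟩ := (isCompact_closedDisk ha.le).exists_bound_of_continuousOn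
    (hh.continuous_fderiv one_ne_zero).continuousOn
  have hL0 : 0 ≤ L := (norm_nonneg _).trans (hL 0 (by simp [mem_closedDisk, sq_nonneg]))
  refine ⟨L / a, by positivity, fun q hq => ?_⟩
  have hq' : q.1 ^ 2 + q.2 ^ 2 < a ^ 2 := mem_openDisk.1 hq
  by_cases hq0 : q = 0
  · rw [hq0, h0, norm_zero]
    rw [hq0] at hq'
    exact mul_nonneg (by positivity) (sub_nonneg.2 hq'.le)
  have hpos : 0 < q.1 ^ 2 + q.2 ^ 2 := by
    by_contra hn
    have h1 : q.1 = 0 := by nlinarith [sq_nonneg q.1, sq_nonneg q.2]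
    have h2 : q.2 = 0 := by nlinarith [sq_nonneg q.1, sq_nonneg q.2]
    exact hq0 (Prod.ext h1 h2)
  set r := √(q.1 ^ 2 + q.2 ^ 2) with hr
  have hr2 : r ^ 2 = q.1 ^ 2 + q.2 ^ 2 := Real.sq_sqrt hpos.le
  have hr0 : 0 < r := Real.sqrt_pos.2 hpos
  have hra : r < a := by nlinarith
  have hcirc : ((a / r) • q).1 ^ 2 + ((a / r) • q).2 ^ 2 = a ^ 2 := by
    simp only [Prod.smul_fst, Prod.smul_snd, smul_eq_mul, mul_pow]
    rw [← mul_add, ← hr2]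
    field_simp
  have hnorm : ‖q‖ ≤ r := by
    rw [Prod.norm_def]
    refine max_le ?_ ?_ <;> rw [Real.norm_eq_abs] <;> apply Real.abs_le_sqrt <;> nlinarith
  have hmv := (convex_closedDisk a).norm_image_sub_le_of_norm_fderiv_le (𝕜 := ℝ) (f := h)
    (fun x _ => hh.differentiable one_ne_zero x) hL
    (mem_closedDisk.2 hcirc.le) (openDisk_subset_closedDisk a hq)
  rw [hz _ hcirc, sub_zero] at hmv
  have hdist : ‖q - (a / r) • q‖ ≤ a - r := by
    have : q - (a / r) • q = (1 - a / r) • q := by rw [sub_smul, one_smul]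
    rw [this, norm_smul, Real.norm_eq_abs, abs_sub_comm, abs_of_nonneg
      (sub_nonneg.2 ((one_le_div hr0).2 hra.le))]
    calc (a / r - 1) * ‖q‖ ≤ (a / r - 1) * r :=
          mul_le_mul_of_nonneg_left hnorm (sub_nonneg.2 ((one_le_div hr0).2 hra.le))
      _ = a - r := by field_simp
  calc ‖h q‖ ≤ L * ‖q - (a / r) • q‖ := hmv
    _ ≤ L * (a - r) := mul_le_mul_of_nonneg_left hdist hL0
    _ ≤ L / a * (a ^ 2 - (q.1 ^ 2 + q.2 ^ 2)) := by
      rw [← hr2, div_mul_eq_mul_div, le_div_iff₀ ha, mul_assoc]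
      exact mul_le_mul_of_nonneg_left (by nlinarith) hL0

/-- The radial cutoff used in the divergence theorem on a disk: it vanishes near the boundary and
outside of the disk and tends to `1` inside as `n → ∞`. -/
noncomputable def diskCutoff (a : ℝ) (n : ℕ) (q : ℝ × ℝ) : ℝ :=
  Real.smoothTransition (n * (a ^ 2 - (q.1 ^ 2 + q.2 ^ 2)) - 1)

lemma contDiff_diskCutoff (a : ℝ) (n : ℕ) : ContDiff ℝ 1 (diskCutoff a n) :=
  (Real.smoothTransition.contDiff (n := 1)).comp (by fun_prop)

lemma diskCutoff_of_notMem {a : ℝ} (n : ℕ) {q : ℝ × ℝ} (hq : q ∉ openDisk a) :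
    diskCutoff a n q = 0 := by
  rw [mem_openDisk, not_lt] at hq
  refine Real.smoothTransition.zero_of_nonpos ?_
  nlinarith [mul_nonneg n.cast_nonneg (sub_nonneg.2 hq) (α := ℝ)]

lemma fderiv_diskCutoff (a : ℝ) (n : ℕ) (q v : ℝ × ℝ) :
    fderiv ℝ (diskCutoff a n) q v =
      deriv Real.smoothTransition (n * (a ^ 2 - (q.1 ^ 2 + q.2 ^ 2)) - 1) *
        (n * (-(2 * (q.1 * v.1 + q.2 * v.2)))) := by
  have hT := ((Real.smoothTransition.contDiff (n := 1)).differentiable one_ne_zero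
    (n * (a ^ 2 - (q.1 ^ 2 + q.2 ^ 2)) - 1)).hasDerivAt
  have h1 : HasFDerivAt (fun p : ℝ × ℝ => p.1) (ContinuousLinearMap.fst ℝ ℝ ℝ) q := hasFDerivAt_fst
  have h2 : HasFDerivAt (fun p : ℝ × ℝ => p.2) (ContinuousLinearMap.snd ℝ ℝ ℝ) q := hasFDerivAt_snd
  have hs := ((((h1.pow 2).add (h2.pow 2)).const_sub (a ^ 2)).const_mul (n : ℝ)).sub_const 1
  have := (hT.comp_hasFDerivAt q hs).fderiv
  unfold diskCutoff
  rw [show (fun q : ℝ × ℝ => Real.smoothTransition (n * (a ^ 2 - (q.1 ^ 2 + q.2 ^ 2)) - 1)) =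
    Real.smoothTransition ∘ fun q : ℝ × ℝ => n * (a ^ 2 - (q.1 ^ 2 + q.2 ^ 2)) - 1 from rfl]
  erw [this]
  simp
  ring

lemma planeDiv_diskCutoff_smul {F G : ℝ × ℝ → ℂ} (hF : ContDiff ℝ 1 F) (hG : ContDiff ℝ 1 G)
    (a : ℝ) (n : ℕ) (q : ℝ × ℝ) :
    planeDiv (fun p => diskCutoff a n p • F p) (fun p => diskCutoff a n p • G p) q =
      diskCutoff a n q • planeDiv F G q +
        (-(2 * n * deriv Real.smoothTransition (n * (a ^ 2 - (q.1 ^ 2 + q.2 ^ 2)) - 1))) •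
          (q.1 • F q + q.2 • G q) := by
  have hχ := (contDiff_diskCutoff a n).differentiable one_ne_zero q
  unfold planeDiv
  rw [fderiv_fun_smul hχ (hF.differentiable one_ne_zero q),
    fderiv_fun_smul hχ (hG.differentiable one_ne_zero q)]
  simp only [add_apply, smul_apply, ContinuousLinearMap.smulRight_apply,
    fderiv_diskCutoff, Complex.real_smul]
  push_cast
  ring

/-- The divergence theorem on a disk for a `C¹` field tangent to the boundary circle. -/
theorem integral_planeDiv_openDisk_eq_zero {a : ℝ} (ha : 0 < a) {F G : ℝ × ℝ → ℂ}
    (hF : ContDiff ℝ 1 F) (hG : ContDiff ℝ 1 G)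
    (hz : ∀ q : ℝ × ℝ, q.1 ^ 2 + q.2 ^ 2 = a ^ 2 → q.1 • F q + q.2 • G q = 0) :
    ∫ p in openDisk a, planeDiv F G p = 0 := by
  obtain ⟨L, hL0, hL⟩ := exists_bound_of_eq_zero_on_circle ha
    (h := fun q => q.1 • F q + q.2 • G q)
    ((contDiff_fst.smul hF).add (contDiff_snd.smul hG)) (by simp) hz
  obtain ⟨M, hM0, hM⟩ := exists_bound_deriv_smoothTransition
  obtain ⟨B, hB⟩ := (isCompact_closedDisk ha.le).exists_bound_of_continuousOn
    (continuous_planeDiv hF hG).continuousOn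
  set Φ : ℕ → ℝ × ℝ → ℂ := fun n =>
    planeDiv (fun p => diskCutoff a n p • F p) (fun p => diskCutoff a n p • G p) with hΦ
  have hΦc (n : ℕ) : Continuous (Φ n) := continuous_planeDiv
    ((contDiff_diskCutoff a n).smul hF) ((contDiff_diskCutoff a n).smul hG)
  have hΦ_zero (n : ℕ) (q : ℝ × ℝ) (hq : q ∉ openDisk a) : Φ n q = 0 := by
    have h1 := diskCutoff_of_notMem n hq
    rw [mem_openDisk, not_lt] at hq
    simp only [hΦ]
    rw [planeDiv_diskCutoff_smul hF hG, h1, deriv_smoothTransition_of_nonpos]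
    · simp
    · nlinarith [mul_nonneg n.cast_nonneg (sub_nonneg.2 hq) (α := ℝ)]
  have hΦ_int (n : ℕ) : ∫ p in openDisk a, Φ n p = 0 := by
    rw [← setIntegral_eq_of_subset_of_forall_sdiff_eq_zero measurableSet_Icc
      ((openDisk_subset_closedDisk a).trans (closedDisk_subset_Icc ha.le))
      (fun q hq => hΦ_zero n q hq.2)]
    simp only [hΦ]
    rw [integral_planeDiv_Icc (F := fun p => diskCutoff a n p • F p)
      (G := fun p => diskCutoff a n p • G p) ((contDiff_diskCutoff a n).smul hF)
      ((contDiff_diskCutoff a n).smul hG) (by constructor <;> simp [ha.le])]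
    have e1 (x : ℝ) : diskCutoff a n (x, a) = 0 :=
      diskCutoff_of_notMem n (by simp [mem_openDisk, sq_nonneg])
    have e2 (x : ℝ) : diskCutoff a n (x, -a) = 0 :=
      diskCutoff_of_notMem n (by simp [mem_openDisk, sq_nonneg])
    have e3 (x : ℝ) : diskCutoff a n (a, x) = 0 :=
      diskCutoff_of_notMem n (by simp [mem_openDisk, sq_nonneg])
    have e4 (x : ℝ) : diskCutoff a n (-a, x) = 0 :=
      diskCutoff_of_notMem n (by simp [mem_openDisk, sq_nonneg])
    simp [e1, e2, e3, e4]
  have hfin : volume (openDisk a) ≠ ⊤ := ((measure_mono (openDisk_subset_closedDisk a)).trans_lt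
    (isCompact_closedDisk ha.le).measure_lt_top).ne
  have hlim : Tendsto (fun n => ∫ p in openDisk a, Φ n p) atTop
      (𝓝 (∫ p in openDisk a, planeDiv F G p)) := by
    refine tendsto_integral_of_dominated_convergence (fun _ => B + 4 * M * L)
      (fun n => (hΦc n).aestronglyMeasurable) (integrableOn_const hfin) (fun n => ?_) ?_
    · filter_upwards [ae_restrict_mem (isOpen_openDisk a).measurableSet] with q hq
      have ht : 0 < a ^ 2 - (q.1 ^ 2 + q.2 ^ 2) := sub_pos.2 (mem_openDisk.1 hq)
      simp only [hΦ]
      rw [planeDiv_diskCutoff_smul hF hG]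
      refine (norm_add_le _ _).trans (add_le_add ?_ ?_)
      · rw [norm_smul, Real.norm_eq_abs, diskCutoff, abs_of_nonneg (Real.smoothTransition.nonneg _)]
        exact (mul_le_of_le_one_left (norm_nonneg _) (Real.smoothTransition.le_one _)).trans
          (hB q (openDisk_subset_closedDisk a hq))
      · rcases le_or_gt 1 (n * (a ^ 2 - (q.1 ^ 2 + q.2 ^ 2)) - 1) with h | h
        · rw [deriv_smoothTransition_of_one_le h]
          simp only [mul_zero, neg_zero, zero_smul, norm_zero]
          positivity
        · rw [norm_smul, norm_neg, norm_mul, Real.norm_eq_abs, Real.norm_eq_abs,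
            abs_of_nonneg (by positivity : (0 : ℝ) ≤ 2 * n)]
          calc 2 * n * |deriv Real.smoothTransition (n * (a ^ 2 - (q.1 ^ 2 + q.2 ^ 2)) - 1)| *
                ‖q.1 • F q + q.2 • G q‖
              ≤ 2 * n * M * (L * (a ^ 2 - (q.1 ^ 2 + q.2 ^ 2))) := by
                gcongr
                · exact hM _
                · exact hL q hq
            _ = 2 * M * L * (n * (a ^ 2 - (q.1 ^ 2 + q.2 ^ 2))) := by ring
            _ ≤ 2 * M * L * 2 := by gcongr; linarith
            _ = 4 * M * L := by ring
    · filter_upwards [ae_restrict_mem (isOpen_openDisk a).measurableSet] with q hq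
      have ht : 0 < a ^ 2 - (q.1 ^ 2 + q.2 ^ 2) := sub_pos.2 (mem_openDisk.1 hq)
      refine tendsto_const_nhds.congr' ?_
      filter_upwards [(tendsto_natCast_atTop_atTop (R := ℝ)).eventually_ge_atTop
        (2 / (a ^ 2 - (q.1 ^ 2 + q.2 ^ 2)))] with n hn
      rw [div_le_iff₀ ht] at hn
      have h : 1 ≤ n * (a ^ 2 - (q.1 ^ 2 + q.2 ^ 2)) - 1 := by linarith
      simp only [hΦ]
      rw [planeDiv_diskCutoff_smul hF hG, deriv_smoothTransition_of_one_le h, diskCutoff,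
        Real.smoothTransition.one_of_one_le h]
      simp
  simp only [hΦ_int] at hlim
  exact tendsto_nhds_unique hlim tendsto_const_nhds

/-- The component in direction `v` of the field `conj W · ∇W`. -/
noncomputable def conjFlux (W : ℝ × ℝ → ℂ) (v p : ℝ × ℝ) : ℂ :=
  (starRingEnd ℂ) (W p) * fderiv ℝ W p v

lemma contDiff_fderiv_apply {W : ℝ × ℝ → ℂ} (hW : ContDiff ℝ 2 W) (v : ℝ × ℝ) :
    ContDiff ℝ 1 fun p => fderiv ℝ W p v :=
  (hW.fderiv_right (m := 1) (by norm_num)).clm_apply contDiff_const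

lemma contDiff_conj_comp {W : ℝ × ℝ → ℂ} {n : ℕ∞} (hW : ContDiff ℝ n W) :
    ContDiff ℝ n fun p => (starRingEnd ℂ) (W p) :=
  Complex.conjCLE.contDiff.comp hW

lemma contDiff_conjFlux {W : ℝ × ℝ → ℂ} (hW : ContDiff ℝ 2 W) (v : ℝ × ℝ) :
    ContDiff ℝ 1 (conjFlux W v) :=
  (contDiff_conj_comp (hW.of_le (by norm_num) : ContDiff ℝ (1 : ℕ∞) W)).mul
    (contDiff_fderiv_apply hW v)

lemma fderiv_conjFlux_apply {W : ℝ × ℝ → ℂ} (hW : ContDiff ℝ 2 W) (v p : ℝ × ℝ) :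
    fderiv ℝ (conjFlux W v) p v = ((‖fderiv ℝ W p v‖ ^ 2 : ℝ) : ℂ) +
      (starRingEnd ℂ) (W p) * fderiv ℝ (fun q => fderiv ℝ W q v) p v := by
  have h1 : HasFDerivAt (fun q => (starRingEnd ℂ) (W q))
      ((Complex.conjCLE : ℂ →L[ℝ] ℂ).comp (fderiv ℝ W p)) p :=
    (Complex.conjCLE : ℂ →L[ℝ] ℂ).hasFDerivAt.comp p
      (hW.differentiable two_ne_zero p).hasFDerivAt
  have h2 := ((contDiff_fderiv_apply hW v).differentiable one_ne_zero p).hasFDerivAt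
  have h3 : fderiv ℝ (conjFlux W v) p = _ := (h1.mul h2).fderiv
  rw [h3]
  simp only [add_apply, smul_apply, ContinuousLinearMap.comp_apply, smul_eq_mul,
    ContinuousLinearEquiv.coe_coe, Complex.conjCLE_apply, Complex.mul_conj, Complex.normSq_eq_norm_sq]
  ring

lemma planeDiv_conjFlux {W : ℝ × ℝ → ℂ} (hW : ContDiff ℝ 2 W) (p : ℝ × ℝ) :
    planeDiv (conjFlux W (1, 0)) (conjFlux W (0, 1)) p =
      ((‖fderiv ℝ W p (1, 0)‖ ^ 2 + ‖fderiv ℝ W p (0, 1)‖ ^ 2 : ℝ) : ℂ) +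
        (starRingEnd ℂ) (W p) * lap W p := by
  rw [planeDiv, fderiv_conjFlux_apply hW, fderiv_conjFlux_apply hW, lap]
  push_cast
  ring

lemma lap_congr {f g : ℝ × ℝ → ℂ} {p : ℝ × ℝ} (h : f =ᶠ[𝓝 p] g) : lap f p = lap g p := by
  have key (v : ℝ × ℝ) : (fun q => fderiv ℝ f q v) =ᶠ[𝓝 p] fun q => fderiv ℝ g q v := by
    filter_upwards [h.fderiv (𝕜 := ℝ)] with q hq
    rw [hq]
  rw [lap, lap, (key _).fderiv_eq, (key _).fderiv_eq]

lemma conjFlux_add_eq {W : ℝ × ℝ → ℂ} (hW : Differentiable ℝ W) {c : ℂ}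
    (hc : (starRingEnd ℂ) c * c = 1) {p t : ℝ × ℝ} (h : ∀ᶠ r in 𝓝 p, W (r + t) = c * W r)
    (v : ℝ × ℝ) : conjFlux W v (p + t) = conjFlux W v p := by
  have h1 : fderiv ℝ W (p + t) = fderiv ℝ (fun r => c * W r) p := by
    rw [← fderiv_comp_add_right]
    exact EventuallyEq.fderiv_eq h
  rw [conjFlux, conjFlux, h1, h.self_of_nhds, fderiv_const_mul (hW p)]
  simp only [smul_apply, smul_eq_mul, map_mul]
  linear_combination (starRingEnd ℂ) (W p) * fderiv ℝ W p v * hc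

lemma conj_exp_I_mul_mul_self (x : ℝ) :
    (starRingEnd ℂ) (Complex.exp (Complex.I * x)) * Complex.exp (Complex.I * x) = 1 := by
  rw [← Complex.exp_conj, ← Complex.exp_add]
  simp

lemma half_le_abs_sub_int_mul {τ x : ℝ} (hx : |x| ≤ τ / 2) {m : ℤ} (hm : m ≠ 0) :
    τ / 2 ≤ |x - m * τ| := by
  obtain ⟨h1, h2⟩ := abs_le.1 hx
  rcases lt_or_gt_of_ne hm with h | h
  · have : (m : ℝ) ≤ -1 := by exact_mod_cast (by omega : m ≤ -1)
    exact le_trans (by nlinarith) (le_abs_self _)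
  · have : (1 : ℝ) ≤ m := by exact_mod_cast h
    exact le_trans (by nlinarith) (neg_le_abs _)

lemma half_le_abs_half_sub_int_mul {τ : ℝ} (hτ : 0 < τ) (m : ℤ) : τ / 2 ≤ |τ / 2 - m * τ| := by
  by_cases hm : m = 0
  · simp [hm, le_abs_self]
  · exact half_le_abs_sub_int_mul (by rw [abs_of_pos (by positivity)]) hm

lemma half_le_abs_neg_half_sub_int_mul {τ : ℝ} (hτ : 0 < τ) (m : ℤ) :
    τ / 2 ≤ |-τ / 2 - m * τ| := by
  have := half_le_abs_half_sub_int_mul hτ (-m)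
  rwa [← abs_neg, Int.cast_neg, show -(τ / 2 - -(m : ℝ) * τ) = -τ / 2 - m * τ by ring] at this

lemma mem_disks {τ₁ τ₂ a : ℝ} {q : ℝ × ℝ} : q ∈ disks τ₁ τ₂ a ↔
    ∃ m n : ℤ, (q.1 - m * τ₁) ^ 2 + (q.2 - n * τ₂) ^ 2 < a ^ 2 := by
  constructor
  · rintro ⟨_, ⟨m, n, rfl⟩, h⟩
    exact ⟨m, n, h⟩
  · rintro ⟨m, n, h⟩
    exact ⟨_, ⟨m, n, rfl⟩, h⟩

lemma isOpen_disks (τ₁ τ₂ a : ℝ) : IsOpen (disks τ₁ τ₂ a) := by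
  have : disks τ₁ τ₂ a = ⋃ m : ℤ, ⋃ n : ℤ,
      {q : ℝ × ℝ | (q.1 - m * τ₁) ^ 2 + (q.2 - n * τ₂) ^ 2 < a ^ 2} := by
    ext q
    simp [mem_disks]
  rw [this]
  exact isOpen_iUnion fun m => isOpen_iUnion fun n => isOpen_lt (by fun_prop) continuous_const

lemma openDisk_subset_disks (τ₁ τ₂ a : ℝ) : openDisk a ⊆ disks τ₁ τ₂ a :=
  fun q hq => mem_disks.2 ⟨0, 0, by simpa using mem_openDisk.1 hq⟩

lemma mem_cell {τ₁ τ₂ : ℝ} {q : ℝ × ℝ} :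
    q ∈ cell τ₁ τ₂ ↔ |q.1| ≤ τ₁ / 2 ∧ |q.2| ≤ τ₂ / 2 := by
  simp only [cell, mem_prod, mem_Icc, abs_le, neg_div]

lemma mem_openDisk_of_mem_disks {τ₁ τ₂ a : ℝ} (ha : 0 < a) (h₁ : a < τ₁ / 2) (h₂ : a < τ₂ / 2)
    {q : ℝ × ℝ} (hq : q ∈ disks τ₁ τ₂ a) (hc : q ∈ cell τ₁ τ₂) : q ∈ openDisk a := by
  obtain ⟨m, n, h⟩ := mem_disks.1 hq
  obtain ⟨hx, hy⟩ := mem_cell.1 hc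
  by_cases hm : m = 0
  · by_cases hn : n = 0
    · rw [mem_openDisk]
      simpa [hm, hn] using h
    · have := half_le_abs_sub_int_mul hy hn
      nlinarith [sq_abs (q.2 - n * τ₂), sq_nonneg (q.1 - m * τ₁)]
  · have := half_le_abs_sub_int_mul hx hm
    nlinarith [sq_abs (q.1 - m * τ₁), sq_nonneg (q.2 - n * τ₂)]

lemma notMem_disks_of_abs_fst {τ₁ τ₂ a s : ℝ} (ha : 0 < a)
    (hs : ∀ m : ℤ, τ₁ / 2 ≤ |s - m * τ₁|) {q : ℝ × ℝ} (hq : |q.1 - s| < τ₁ / 2 - a) :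
    q ∉ disks τ₁ τ₂ a := by
  intro h
  obtain ⟨m, n, h⟩ := mem_disks.1 h
  have h3 : |s - m * τ₁| ≤ |q.1 - m * τ₁| + |q.1 - s| := by
    rw [abs_sub_comm q.1 s, add_comm]
    exact abs_sub_le _ _ _
  have h4 : a < |q.1 - m * τ₁| := by linarith [hs m]
  nlinarith [sq_abs (q.1 - m * τ₁), sq_nonneg (q.2 - n * τ₂)]

lemma notMem_disks_of_abs_snd {τ₁ τ₂ a s : ℝ} (ha : 0 < a)
    (hs : ∀ n : ℤ, τ₂ / 2 ≤ |s - n * τ₂|) {q : ℝ × ℝ} (hq : |q.2 - s| < τ₂ / 2 - a) :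
    q ∉ disks τ₁ τ₂ a := by
  intro h
  obtain ⟨m, n, h⟩ := mem_disks.1 h
  refine notMem_disks_of_abs_fst (τ₁ := τ₂) (τ₂ := τ₁) ha hs (q := (q.2, q.1)) hq ?_
  exact mem_disks.2 ⟨n, m, by linarith⟩

/-- The part of the open fundamental cell outside of the closed central disk. -/
def exteriorCell (τ₁ τ₂ a : ℝ) : Set (ℝ × ℝ) :=
  (Ioo (-τ₁ / 2) (τ₁ / 2) ×ˢ Ioo (-τ₂ / 2) (τ₂ / 2)) \ closedDisk a

lemma isOpen_exteriorCell (τ₁ τ₂ a : ℝ) : IsOpen (exteriorCell τ₁ τ₂ a) :=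
  (isOpen_Ioo.prod isOpen_Ioo).sdiff (isClosed_closedDisk a)

lemma exteriorCell_subset_cell (τ₁ τ₂ a : ℝ) : exteriorCell τ₁ τ₂ a ⊆ cell τ₁ τ₂ :=
  sdiff_subset.trans (prod_mono Ioo_subset_Icc_self Ioo_subset_Icc_self)

lemma isCompact_cell (τ₁ τ₂ : ℝ) : IsCompact (cell τ₁ τ₂) := isCompact_Icc.prod isCompact_Icc

lemma closedDisk_subset_cell {τ₁ τ₂ a : ℝ} (ha : 0 < a) (h₁ : a < τ₁ / 2) (h₂ : a < τ₂ / 2) :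
    closedDisk a ⊆ cell τ₁ τ₂ := by
  intro q hq
  obtain ⟨⟨h3, h4⟩, ⟨h5, h6⟩⟩ := closedDisk_subset_Icc ha.le hq
  simp only at h3 h4 h5 h6
  exact mem_cell.2 ⟨abs_le.2 ⟨by linarith, by linarith⟩, abs_le.2 ⟨by linarith, by linarith⟩⟩

lemma disjoint_openDisk_exteriorCell (τ₁ τ₂ a : ℝ) :
    Disjoint (openDisk a) (exteriorCell τ₁ τ₂ a) :=
  disjoint_left.2 fun _ h h' => h'.2 (openDisk_subset_closedDisk a h)

lemma notMem_closure_disks {τ₁ τ₂ a : ℝ} (ha : 0 < a) (h₁ : a < τ₁ / 2) (h₂ : a < τ₂ / 2)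
    {q : ℝ × ℝ} (hq : q ∈ exteriorCell τ₁ τ₂ a) : q ∉ closure (disks τ₁ τ₂ a) := by
  intro h
  obtain ⟨r, hr, hr'⟩ := mem_closure_iff.1 h _ (isOpen_exteriorCell τ₁ τ₂ a) hq
  exact hr.2 (openDisk_subset_closedDisk a
    (mem_openDisk_of_mem_disks ha h₁ h₂ hr' (exteriorCell_subset_cell τ₁ τ₂ a hr)))

lemma cell_ae_eq {τ₁ τ₂ a : ℝ} (ha : 0 < a) (h₁ : a < τ₁ / 2) (h₂ : a < τ₂ / 2) :
    cell τ₁ τ₂ =ᵐ[volume] (openDisk a ∪ exteriorCell τ₁ τ₂ a : Set (ℝ × ℝ)) := by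
  have hsub : openDisk a ∪ exteriorCell τ₁ τ₂ a ⊆ cell τ₁ τ₂ :=
    union_subset ((openDisk_subset_closedDisk a).trans (closedDisk_subset_cell ha h₁ h₂))
      (exteriorCell_subset_cell τ₁ τ₂ a)
  have hfr : volume (frontier (cell τ₁ τ₂)) = 0 :=
    ((convex_Icc _ _).prod (convex_Icc _ _)).addHaar_frontier volume
  have hint : interior (cell τ₁ τ₂) = Ioo (-τ₁ / 2) (τ₁ / 2) ×ˢ Ioo (-τ₂ / 2) (τ₂ / 2) := by
    rw [cell, interior_prod_eq, interior_Icc, interior_Icc]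
  refine (ae_eq_set.2 ⟨?_, by rw [sdiff_eq_empty.2 hsub, measure_empty]⟩)
  refine measure_mono_null (t := frontier (cell τ₁ τ₂) ∪ (closedDisk a \ openDisk a)) ?_
    (measure_union_null hfr (volume_closedDisk_diff_openDisk ha))
  rintro q ⟨hq, hq'⟩
  rw [mem_union, not_or] at hq'
  by_cases hd : q ∈ closedDisk a
  · exact Or.inr ⟨hd, hq'.1⟩
  · refine Or.inl ⟨subset_closure hq, fun hi => hq'.2 ⟨hint ▸ hi, hd⟩⟩

lemma setIntegral_cell_eq_add {E : Type*} [NormedAddCommGroup E] [NormedSpace ℝ E]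
    {τ₁ τ₂ a : ℝ} (ha : 0 < a) (h₁ : a < τ₁ / 2) (h₂ : a < τ₂ / 2) {f : ℝ × ℝ → E}
    (hD : IntegrableOn f (openDisk a)) (hE : IntegrableOn f (exteriorCell τ₁ τ₂ a)) :
    ∫ p in cell τ₁ τ₂, f p =
      (∫ p in openDisk a, f p) + ∫ p in exteriorCell τ₁ τ₂ a, f p := by
  rw [setIntegral_congr_set (cell_ae_eq ha h₁ h₂),
    setIntegral_union (disjoint_openDisk_exteriorCell τ₁ τ₂ a)
      (isOpen_exteriorCell τ₁ τ₂ a).measurableSet hD hE]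

lemma integral_planeDiv_conjFlux_cell {τ₁ τ₂ a : ℝ} (ha : 0 < a) (h₁ : a < τ₁ / 2)
    (h₂ : a < τ₂ / 2) {u W : ℝ × ℝ → ℂ} (hW : ContDiff ℝ 2 W)
    (hWu : ∀ q ∉ disks τ₁ τ₂ a, W q = u q) {c₁ c₂ : ℂ}
    (hc₁ : (starRingEnd ℂ) c₁ * c₁ = 1) (hc₂ : (starRingEnd ℂ) c₂ * c₂ = 1)
    (hu₁ : ∀ r : ℝ × ℝ, u (r.1 + τ₁, r.2) = c₁ * u r)
    (hu₂ : ∀ r : ℝ × ℝ, u (r.1, r.2 + τ₂) = c₂ * u r) :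
    ∫ p in cell τ₁ τ₂, planeDiv (conjFlux W (1, 0)) (conjFlux W (0, 1)) p = 0 := by
  have hτ₁ : 0 < τ₁ := by linarith
  have hτ₂ : 0 < τ₂ := by linarith
  have hdiff := hW.differentiable two_ne_zero
  have hx (v : ℝ × ℝ) (y : ℝ) : conjFlux W v (τ₁ / 2, y) = conjFlux W v (-τ₁ / 2, y) := by
    have hev : ∀ᶠ r : ℝ × ℝ in 𝓝 (-τ₁ / 2, y), |r.1 - -τ₁ / 2| < τ₁ / 2 - a :=
      (isOpen_lt (by fun_prop) continuous_const).mem_nhds (by simpa using h₁)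
    have := conjFlux_add_eq hdiff hc₁ (p := (-τ₁ / 2, y)) (t := (τ₁, 0)) ?_ v
    · rw [← this, Prod.mk_add_mk, add_zero]
      congr 2
      ring
    filter_upwards [hev] with r hr
    rw [hWu r (notMem_disks_of_abs_fst ha (half_le_abs_neg_half_sub_int_mul hτ₁) hr), ← hu₁,
      ← hWu _ (notMem_disks_of_abs_fst ha (half_le_abs_half_sub_int_mul hτ₁) (?_))]
    · congr 1
      ext <;> simp
    · convert hr using 2
      simp only
      ring
  have hy (v : ℝ × ℝ) (x : ℝ) : conjFlux W v (x, τ₂ / 2) = conjFlux W v (x, -τ₂ / 2) := by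
    have hev : ∀ᶠ r : ℝ × ℝ in 𝓝 (x, -τ₂ / 2), |r.2 - -τ₂ / 2| < τ₂ / 2 - a :=
      (isOpen_lt (by fun_prop) continuous_const).mem_nhds (by simpa using h₂)
    have := conjFlux_add_eq hdiff hc₂ (p := (x, -τ₂ / 2)) (t := (0, τ₂)) ?_ v
    · rw [← this, Prod.mk_add_mk, add_zero]
      congr 2
      ring
    filter_upwards [hev] with r hr
    rw [hWu r (notMem_disks_of_abs_snd ha (half_le_abs_neg_half_sub_int_mul hτ₂) hr), ← hu₂,
      ← hWu _ (notMem_disks_of_abs_snd ha (half_le_abs_half_sub_int_mul hτ₂) (?_))]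
    · congr 1
      ext <;> simp
    · convert hr using 2
      simp only
      ring
  have hcell : cell τ₁ τ₂ = Icc (-τ₁ / 2, -τ₂ / 2) (τ₁ / 2, τ₂ / 2) := by
    rw [Icc_prod_eq, cell]
  rw [hcell, integral_planeDiv_Icc (contDiff_conjFlux hW _) (contDiff_conjFlux hW _)
    ⟨by simp only; linarith, by simp only; linarith⟩]
  simp only [hx, hy]
  ring

lemma fderiv_apply_self_eq (f : ℝ × ℝ → ℂ) (q : ℝ × ℝ) :
    fderiv ℝ f q q = q.1 * fderiv ℝ f q (1, 0) + q.2 * fderiv ℝ f q (0, 1) := by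
  have : q = q.1 • (1, 0) + q.2 • (0, 1) := by ext <;> simp
  conv_lhs => rw [this, map_add, map_smul, map_smul]
  rw [← this, Complex.real_smul, Complex.real_smul]

lemma integral_planeDiv_conjFlux_openDisk {a : ℝ} (ha : 0 < a) {c : ℂ} {V W : ℝ × ℝ → ℂ}
    (hV : ContDiff ℝ 2 V) (hW : ContDiff ℝ 2 W)
    (heq : ∀ q : ℝ × ℝ, q.1 ^ 2 + q.2 ^ 2 = a ^ 2 → V q = W q)
    (hflux : ∀ q : ℝ × ℝ, q.1 ^ 2 + q.2 ^ 2 = a ^ 2 → c * fderiv ℝ V q q = fderiv ℝ W q q) :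
    ∫ p in openDisk a, planeDiv (conjFlux W (1, 0)) (conjFlux W (0, 1)) p =
      c * ∫ p in openDisk a, planeDiv (conjFlux V (1, 0)) (conjFlux V (0, 1)) p := by
  have hVv (v) := contDiff_conjFlux hV v
  have hWv (v) := contDiff_conjFlux hW v
  have hint {F G : ℝ × ℝ → ℂ} (hF : ContDiff ℝ 1 F) (hG : ContDiff ℝ 1 G) :
      IntegrableOn (planeDiv F G) (openDisk a) :=
    ((continuous_planeDiv hF hG).continuousOn.integrableOn_compact
      (isCompact_closedDisk ha.le)).mono_set (openDisk_subset_closedDisk a)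
  have key := integral_planeDiv_openDisk_eq_zero ha
    (F := fun p => c * conjFlux V (1, 0) p - conjFlux W (1, 0) p)
    (G := fun p => c * conjFlux V (0, 1) p - conjFlux W (0, 1) p)
    ((contDiff_const.mul (hVv _)).sub (hWv _)) ((contDiff_const.mul (hVv _)).sub (hWv _))
    (fun q hq => by
      have := hflux q hq
      rw [fderiv_apply_self_eq, fderiv_apply_self_eq] at this
      simp only [conjFlux, heq q hq, Complex.real_smul]
      linear_combination (starRingEnd ℂ) (W q) * this)
  have hdiv (p : ℝ × ℝ) : planeDiv (fun p => c * conjFlux V (1, 0) p - conjFlux W (1, 0) p)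
      (fun p => c * conjFlux V (0, 1) p - conjFlux W (0, 1) p) p =
      c * planeDiv (conjFlux V (1, 0)) (conjFlux V (0, 1)) p -
        planeDiv (conjFlux W (1, 0)) (conjFlux W (0, 1)) p := by
    have dV (v) := (hVv v).differentiable one_ne_zero p
    have dW (v) := (hWv v).differentiable one_ne_zero p
    rw [planeDiv, fderiv_fun_sub ((dV _).const_mul c) (dW _),
      fderiv_fun_sub ((dV _).const_mul c) (dW _), fderiv_const_mul (dV _), fderiv_const_mul (dV _)]
    simp only [planeDiv, sub_apply, smul_apply, smul_eq_mul]
    ring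
  simp only [hdiv] at key
  rw [integral_sub ((hint (hVv _) (hVv _)).const_mul c) (hint (hWv _) (hWv _)),
    integral_const_mul] at key
  exact (sub_eq_zero.1 key).symm

/-- If `ΔW = -μ W` on a set, the divergence of `conj W · ∇W` integrates to the Dirichlet energy
minus `μ` times the squared `L²` norm. -/
lemma integral_planeDiv_conjFlux_of_helmholtz {W : ℝ × ℝ → ℂ} (hW : ContDiff ℝ 2 W) {μ : ℂ}
    {s K : Set (ℝ × ℝ)} (hs : MeasurableSet s) (hK : IsCompact K) (hsK : s ⊆ K)
    (hH : ∀ p ∈ s, -lap W p = μ * W p) :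
    ∫ p in s, planeDiv (conjFlux W (1, 0)) (conjFlux W (0, 1)) p =
      ((∫ p in s, (‖fderiv ℝ W p (1, 0)‖ ^ 2 + ‖fderiv ℝ W p (0, 1)‖ ^ 2) : ℝ) : ℂ) -
        μ * ((∫ p in s, ‖W p‖ ^ 2 : ℝ) : ℂ) := by
  have hc (v) : Continuous fun p => fderiv ℝ W p v := (contDiff_fderiv_apply hW v).continuous
  have h1 : IntegrableOn
      (fun p => ‖fderiv ℝ W p (1, 0)‖ ^ 2 + ‖fderiv ℝ W p (0, 1)‖ ^ 2) s :=
    ((((hc _).norm.pow 2).add ((hc _).norm.pow 2)).continuousOn.integrableOn_compact hK).mono_set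
      hsK
  have h2 : IntegrableOn (fun p => ‖W p‖ ^ 2) s :=
    ((hW.continuous.norm.pow 2).continuousOn.integrableOn_compact hK).mono_set hsK
  have h1' : Integrable (fun p => ((‖fderiv ℝ W p (1, 0)‖ ^ 2 + ‖fderiv ℝ W p (0, 1)‖ ^ 2 : ℝ) : ℂ))
      (volume.restrict s) := h1.ofReal
  have h2' : Integrable (fun p => ((‖W p‖ ^ 2 : ℝ) : ℂ)) (volume.restrict s) := h2.ofReal
  rw [← integral_complex_ofReal, ← integral_complex_ofReal, ← integral_const_mul,
    ← integral_sub h1' (h2'.const_mul μ)]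
  refine setIntegral_congr_fun hs fun p hp => ?_
  simp only [planeDiv_conjFlux hW]
  have hn : ((‖W p‖ ^ 2 : ℝ) : ℂ) = W p * (starRingEnd ℂ) (W p) := by
    rw [Complex.mul_conj, Complex.normSq_eq_norm_sq]
  rw [hn, sub_eq_add_neg]
  congr 1
  linear_combination -(starRingEnd ℂ) (W p) * hH p hp

/-- **Green's identity** for a Floquet–Bloch eigenfunction of the transmission
problem: `∫_S (1/ε̃)|∇u|² = λ ∫_S |u|²`. -/
theorem greens_identity (τ₁ τ₂ a ε : ℝ) (hτ₁ : 0 < τ₁) (hτ₂ : 0 < τ₂)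
    (ha : 0 < a) (ha' : a < min τ₁ τ₂ / 2) (hε : 0 < ε)
    (qv : ℝ × ℝ) (lam : ℂ) (u Uin Uex : ℝ × ℝ → ℂ)
    (htrans : IsTransmission τ₁ τ₂ a ε u Uin Uex)
    (hFloq₁ : ∀ r : ℝ × ℝ, u (r.1 + τ₁, r.2) =
      Complex.exp (Complex.I * ((qv.1 * τ₁ : ℝ) : ℂ)) * u r)
    (hFloq₂ : ∀ r : ℝ × ℝ, u (r.1, r.2 + τ₂) =
      Complex.exp (Complex.I * ((qv.2 * τ₂ : ℝ) : ℂ)) * u r)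
    (hHelm_in : ∀ r ∈ disks τ₁ τ₂ a, -lap Uin r = lam * (ε : ℂ) * Uin r)
    (hHelm_ex : ∀ r ∈ (closure (disks τ₁ τ₂ a))ᶜ, -lap Uex r = lam * Uex r) :
    ((∫ r in cell τ₁ τ₂, (1 / epsTilde τ₁ τ₂ a ε r) *
        (‖fderiv ℝ u r (1, 0)‖ ^ 2 + ‖fderiv ℝ u r (0, 1)‖ ^ 2) : ℝ) : ℂ) =
      lam * ((∫ r in cell τ₁ τ₂, ‖u r‖ ^ 2 : ℝ) : ℂ) := by
  obtain ⟨h₁, h₂⟩ : a < τ₁ / 2 ∧ a < τ₂ / 2 :=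
    ⟨ha'.trans_le (by linarith [min_le_left τ₁ τ₂]), ha'.trans_le (by linarith [min_le_right τ₁ τ₂])⟩
  have hε0 : (ε : ℂ) ≠ 0 := by exact_mod_cast hε.ne'
  obtain ⟨N, hN, hDN, hUin⟩ := htrans.smooth_in
  obtain ⟨N', hN', hDN', hUex⟩ := htrans.smooth_ex
  obtain ⟨V, hV, hVU⟩ :=
    exists_contDiff_eventuallyEq_of_isClosed (n := 2) isClosed_closure hN hDN hUin
  obtain ⟨W, hW, hWU⟩ := exists_contDiff_eventuallyEq_of_isClosed (n := 2)
    (isOpen_disks τ₁ τ₂ a).isClosed_compl hN' hDN' hUex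
  have hD_sub := openDisk_subset_disks τ₁ τ₂ a
  have hcirc_in (q : ℝ × ℝ) (hq : q.1 ^ 2 + q.2 ^ 2 = a ^ 2) : V =ᶠ[𝓝 q] Uin :=
    hVU q (closure_mono hD_sub (closedDisk_subset_closure_openDisk ha (mem_closedDisk.2 hq.le)))
  have hcirc_ex (q : ℝ × ℝ) (hq : q.1 ^ 2 + q.2 ^ 2 = a ^ 2) : W =ᶠ[𝓝 q] Uex := by
    refine hWU q fun h => ?_
    have := mem_openDisk.1 (mem_openDisk_of_mem_disks ha h₁ h₂ h
      (closedDisk_subset_cell ha h₁ h₂ (mem_closedDisk.2 hq.le)))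
    exact this.ne hq
  have h0 : ((0, 0) : ℝ × ℝ) ∈ centers τ₁ τ₂ := ⟨0, 0, by simp⟩
  have hdisk := integral_planeDiv_conjFlux_openDisk ha (c := 1 / ε) hV hW
    (fun q hq => by
      rw [(hcirc_in q hq).self_of_nhds, (hcirc_ex q hq).self_of_nhds]
      exact htrans.continuity _ h0 q (by simpa using hq))
    (fun q hq => by
      rw [(hcirc_in q hq).fderiv_eq, (hcirc_ex q hq).fderiv_eq]
      simpa using htrans.flux _ h0 q (by simpa using hq))
  have hcell := integral_planeDiv_conjFlux_cell ha h₁ h₂ hW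
    (fun q hq => by rw [htrans.eq_ex q hq]; exact (hWU q hq).self_of_nhds)
    (conj_exp_I_mul_mul_self _) (conj_exp_I_mul_mul_self _) hFloq₁ hFloq₂
  have hDm := (isOpen_openDisk a).measurableSet
  have hEm := (isOpen_exteriorCell τ₁ τ₂ a).measurableSet
  have hDK := openDisk_subset_closedDisk a
  have hEK := exteriorCell_subset_cell τ₁ τ₂ a
  have hKc := isCompact_closedDisk ha.le
  have hCc := isCompact_cell τ₁ τ₂
  have hc_div := continuous_planeDiv (contDiff_conjFlux hW (1, 0)) (contDiff_conjFlux hW (0, 1))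
  rw [setIntegral_cell_eq_add ha h₁ h₂
    ((hc_div.continuousOn.integrableOn_compact hKc).mono_set hDK)
    ((hc_div.continuousOn.integrableOn_compact hCc).mono_set hEK), hdisk] at hcell
  have hVev (p : ℝ × ℝ) (hp : p ∈ openDisk a) : V =ᶠ[𝓝 p] Uin :=
    hVU p (subset_closure (hD_sub hp))
  have hE_not (p : ℝ × ℝ) (hp : p ∈ exteriorCell τ₁ τ₂ a) : p ∉ closure (disks τ₁ τ₂ a) :=
    notMem_closure_disks ha h₁ h₂ hp
  have hWev (p : ℝ × ℝ) (hp : p ∈ exteriorCell τ₁ τ₂ a) : W =ᶠ[𝓝 p] Uex :=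
    hWU p fun h => hE_not p hp (subset_closure h)
  rw [integral_planeDiv_conjFlux_of_helmholtz hV hDm hKc hDK (μ := lam * ε) (fun p hp => by
      rw [lap_congr (hVev p hp), (hVev p hp).self_of_nhds]
      exact hHelm_in p (hD_sub hp)),
    integral_planeDiv_conjFlux_of_helmholtz hW hEm hCc hEK (μ := lam) (fun p hp => by
      rw [lap_congr (hWev p hp), (hWev p hp).self_of_nhds]
      exact hHelm_ex p (hE_not p hp))] at hcell
  have huV (p : ℝ × ℝ) (hp : p ∈ openDisk a) : u =ᶠ[𝓝 p] V := by
    filter_upwards [hVev p hp, (isOpen_openDisk a).mem_nhds hp] with q hq hqD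
    rw [hq, htrans.eq_in q (hD_sub hqD)]
  have huW (p : ℝ × ℝ) (hp : p ∈ exteriorCell τ₁ τ₂ a) : u =ᶠ[𝓝 p] W := by
    filter_upwards [hWev p hp, isClosed_closure.isOpen_compl.mem_nhds (hE_not p hp)] with q hq hqD
    rw [hq, htrans.eq_ex q fun h => hqD (subset_closure h)]
  have hgrad {f : ℝ × ℝ → ℂ} (hf : ContDiff ℝ 2 f) :
      Continuous fun p => ‖fderiv ℝ f p (1, 0)‖ ^ 2 + ‖fderiv ℝ f p (0, 1)‖ ^ 2 :=
    ((contDiff_fderiv_apply hf _).continuous.norm.pow 2).add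
      ((contDiff_fderiv_apply hf _).continuous.norm.pow 2)
  have hA_D : EqOn (fun r => (1 / epsTilde τ₁ τ₂ a ε r) *
      (‖fderiv ℝ u r (1, 0)‖ ^ 2 + ‖fderiv ℝ u r (0, 1)‖ ^ 2))
      (fun p => 1 / ε * (‖fderiv ℝ V p (1, 0)‖ ^ 2 + ‖fderiv ℝ V p (0, 1)‖ ^ 2))
      (openDisk a) := fun p hp => by
    simp only [epsTilde, if_pos (hD_sub hp), (huV p hp).fderiv_eq]
  have hA_E : EqOn (fun r => (1 / epsTilde τ₁ τ₂ a ε r) *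
      (‖fderiv ℝ u r (1, 0)‖ ^ 2 + ‖fderiv ℝ u r (0, 1)‖ ^ 2))
      (fun p => ‖fderiv ℝ W p (1, 0)‖ ^ 2 + ‖fderiv ℝ W p (0, 1)‖ ^ 2)
      (exteriorCell τ₁ τ₂ a) := fun p hp => by
    simp only [epsTilde, if_neg fun h => hE_not p hp (subset_closure h), (huW p hp).fderiv_eq,
      div_one, one_mul]
  have hB_D : EqOn (fun r => ‖u r‖ ^ 2) (fun p => ‖V p‖ ^ 2) (openDisk a) := fun p hp => by
    simp only [(huV p hp).self_of_nhds]
  have hB_E : EqOn (fun r => ‖u r‖ ^ 2) (fun p => ‖W p‖ ^ 2) (exteriorCell τ₁ τ₂ a) :=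
    fun p hp => by simp only [(huW p hp).self_of_nhds]
  have int_D {f g : ℝ × ℝ → ℝ} (hg : Continuous g) (hfg : EqOn f g (openDisk a)) :
      IntegrableOn f (openDisk a) :=
    ((hg.continuousOn.integrableOn_compact hKc).mono_set hDK).congr_fun hfg.symm hDm
  have int_E {f g : ℝ × ℝ → ℝ} (hg : Continuous g) (hfg : EqOn f g (exteriorCell τ₁ τ₂ a)) :
      IntegrableOn f (exteriorCell τ₁ τ₂ a) :=
    ((hg.continuousOn.integrableOn_compact hCc).mono_set hEK).congr_fun hfg.symm hEm
  rw [setIntegral_cell_eq_add ha h₁ h₂ (int_D (continuous_const.mul (hgrad hV)) hA_D)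
      (int_E (hgrad hW) hA_E),
    setIntegral_cell_eq_add ha h₁ h₂ (int_D (hV.continuous.norm.pow 2) hB_D)
      (int_E (hW.continuous.norm.pow 2) hB_E),
    setIntegral_congr_fun hDm hA_D, setIntegral_congr_fun hEm hA_E,
    setIntegral_congr_fun hDm hB_D, setIntegral_congr_fun hEm hB_E, integral_const_mul]
  push_cast at hcell ⊢
  field_simp at hcell ⊢
  linear_combination hcell
end

section
/- Let u : ℝ² → ℂ be a transmission function (with C² pieces U_in on a neighborhood of the closed disks and U_ex on a neighborhood of the complement of the open disks) which is doubly periodic, i.e. u(r + (τ₁, 0)) = u(r) and u(r + (0, τ₂)) = u(r) for all r ∈ ℝ², and harmonic off the circles: ΔU_in = 0 on D and ΔU_ex = 0 on ℝ² ∖ closure(D). Then u is constant on ℝ². -/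
open MeasureTheory Set
open scoped Classical

open InnerProductSpace Metric Filter Topology

section Harmonic

variable {f : ℂ → ℝ} {c w : ℂ} {R : ℝ}

lemma circleIntegrable_herglotzRieszKernel_mul (hf : HarmonicContOnCl f (ball c R))
    (hw : w ∈ ball c R) :
    CircleIntegrable ((Complex.re ∘ herglotzRieszKernel c w) • f) c R := by
  have hR : 0 ≤ R := (pos_of_mem_ball hw).le
  refine ContinuousOn.circleIntegrable' (ContinuousOn.smul
    (Complex.continuous_re.comp_continuousOn (continuousOn_herglotzRieszKernel_sphere hw))
    (hf.continuousOn_ball.mono ?_))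
  rw [abs_of_nonneg hR]
  exact sphere_subset_closedBall

/-- **Harnack's inequality**, lower bound. -/
lemma harnack_lower (hf : HarmonicContOnCl f (ball c R)) (h0 : ∀ z ∈ closedBall c R, 0 ≤ f z)
    (hw : w ∈ ball c R) : (R - ‖w - c‖) / (R + ‖w - c‖) * f c ≤ f w := by
  have hR : 0 < R := pos_of_mem_ball hw
  have hf' : HarmonicContOnCl f (ball c |R|) := by rwa [abs_of_pos hR]
  rw [← hf.circleAverage_re_herglotzRieszKernel_smul hw, ← hf'.circleAverage_eq, ← smul_eq_mul,
    ← Real.circleAverage_smul]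
  refine Real.circleAverage_mono ?_ (circleIntegrable_herglotzRieszKernel_mul hf hw) ?_
  · exact ContinuousOn.circleIntegrable'
      ((hf'.continuousOn_ball.mono sphere_subset_closedBall).const_smul _)
  · intro z hz
    rw [abs_of_pos hR] at hz
    exact mul_le_mul_of_nonneg_right (le_re_herglotzRieszKernel hz hw)
      (h0 z (sphere_subset_closedBall hz))

/-- **Harnack's inequality**, upper bound. -/
lemma harnack_upper (hf : HarmonicContOnCl f (ball c R)) (h0 : ∀ z ∈ closedBall c R, 0 ≤ f z)
    (hw : w ∈ ball c R) : f w ≤ (R + ‖w - c‖) / (R - ‖w - c‖) * f c := by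
  have hR : 0 < R := pos_of_mem_ball hw
  have hf' : HarmonicContOnCl f (ball c |R|) := by rwa [abs_of_pos hR]
  rw [← hf.circleAverage_re_herglotzRieszKernel_smul hw, ← hf'.circleAverage_eq, ← smul_eq_mul,
    ← Real.circleAverage_smul]
  refine Real.circleAverage_mono (circleIntegrable_herglotzRieszKernel_mul hf hw) ?_ ?_
  · exact ContinuousOn.circleIntegrable'
      ((hf'.continuousOn_ball.mono sphere_subset_closedBall).const_smul _)
  · intro z hz
    rw [abs_of_pos hR] at hz
    exact mul_le_mul_of_nonneg_right (re_herglotzRieszKernel_le hz hw)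
      (h0 z (sphere_subset_closedBall hz))

/-- **Strong maximum principle** on a ball, for a maximum attained at the center. -/
lemma eq_of_max_at_center {M : ℝ} (hf : HarmonicContOnCl f (ball c R))
    (hM : ∀ z ∈ closedBall c R, f z ≤ M) (hc : f c = M) (hw : w ∈ ball c R) : f w = M := by
  have h := harnack_upper (hf.const_sub M) (fun z hz => by simpa using hM z hz) hw
  simp only [Pi.sub_apply, hc, sub_self, mul_zero] at h
  linarith [hM w (ball_subset_closedBall hw)]

/-- **Hopf's boundary point lemma** on a ball, in quantitative form. -/
lemma hopf_boundary {M : ℝ} {q : ℂ} (hf : HarmonicContOnCl f (ball c R))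
    (hM : ∀ z ∈ closedBall c R, f z ≤ M) (hq : q ∈ sphere c R) (hqM : f q = M) (hR : 0 < R)
    (hd : DifferentiableAt ℝ f q) : (M - f c) / 2 ≤ fderiv ℝ f q (q - c) := by
  have hqc : ‖q - c‖ = R := by simpa [dist_eq_norm] using hq
  have hK : 0 ≤ M - f c := sub_nonneg.2 (hM c (mem_closedBall_self hR.le))
  have hline : HasDerivAt (fun t : ℝ => c + t • (q - c)) (q - c) 1 := by
    simpa using ((hasDerivAt_id (1 : ℝ)).smul_const (q - c)).const_add c
  have hd' : HasFDerivAt f (fderiv ℝ f q) (c + (1 : ℝ) • (q - c)) := by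
    simpa using hd.hasFDerivAt
  have hder := (hd'.comp_hasDerivAt (1 : ℝ) hline).hasDerivWithinAt (s := Ioo 0 1)
  rw [hasDerivWithinAt_iff_tendsto_slope' (by simp)] at hder
  have : (𝓝[Ioo (0 : ℝ) 1] 1).NeBot := by
    rw [nhdsWithin_Ioo_eq_nhdsLT one_pos]
    infer_instance
  refine ge_of_tendsto hder (eventually_nhdsWithin_of_forall fun t ht => ?_)
  have hn : ‖c + t • (q - c) - c‖ = t * R := by
    rw [add_sub_cancel_left, norm_smul, hqc, Real.norm_of_nonneg ht.1.le]
  have hw : c + t • (q - c) ∈ ball c R := by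
    rw [mem_ball_iff_norm, hn]
    nlinarith [ht.2]
  have h := harnack_lower (hf.const_sub M) (fun z hz => by simpa using hM z hz) hw
  rw [hn] at h
  have hfrac : (1 - t) / 2 ≤ (R - t * R) / (R + t * R) := by
    rw [div_le_div_iff₀ two_pos (by nlinarith [ht.1])]
    nlinarith [mul_pos (sub_pos.2 ht.2) hR, mul_pos (mul_pos (sub_pos.2 ht.2) hR) (sub_pos.2 ht.2)]
  have h2 := (mul_le_mul_of_nonneg_right hfrac hK).trans h
  simp only [Pi.sub_apply] at h2
  rw [slope_def_field]
  simp only [Function.comp_apply, one_smul, add_sub_cancel, hqM]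
  rw [le_div_iff_of_neg (by linarith [ht.2])]
  nlinarith

end Harmonic

/-- The real-valued transmission problem in the complex plane: `v` is glued from `F` on the open
disks of radius `a` about the points of `C` and `G` off them. -/
structure RealTransmission (C : Set ℂ) (a d k : ℝ) (v F G : ℂ → ℝ) : Prop where
  a_pos : 0 < a
  k_pos : 0 < k
  two_a_lt : 2 * a < d
  sep : ∀ p ∈ C, ∀ p' ∈ C, p ≠ p' → d ≤ dist p p'
  harm_in : ∀ p ∈ C, HarmonicOnNhd F (ball p a)
  harm_ex : ∀ U : Set ℂ, IsOpen U → (∀ y ∈ U, ∀ p ∈ C, a ≤ dist y p) → HarmonicOnNhd G U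
  diff_in : ∀ p ∈ C, ∀ q ∈ sphere p a, DifferentiableAt ℝ F q
  diff_ex : ∀ q, (∀ p ∈ C, a ≤ dist q p) → DifferentiableAt ℝ G q
  eq_in : ∀ p ∈ C, ∀ z ∈ ball p a, v z = F z
  eq_ex : ∀ z, (∀ p ∈ C, a ≤ dist z p) → v z = G z
  continuity : ∀ p ∈ C, ∀ q ∈ sphere p a, F q = G q
  flux : ∀ p ∈ C, ∀ q ∈ sphere p a, k * fderiv ℝ F q (q - p) = fderiv ℝ G q (q - p)

namespace RealTransmission

variable {C : Set ℂ} {a d k M : ℝ} {v F G : ℂ → ℝ}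

lemma le_dist_of_mem_sphere (h : RealTransmission C a d k v F G) {p q p' : ℂ} (hp : p ∈ C)
    (hq : q ∈ sphere p a) (hp' : p' ∈ C) : a ≤ dist q p' := by
  rw [mem_sphere] at hq
  by_cases hpp : p = p'
  · exact hpp ▸ hq.ge
  · have := h.sep p hp p' hp' hpp
    have := dist_triangle_left p p' q
    linarith [h.two_a_lt]

lemma eventually_outside (h : RealTransmission C a d k v F G) {z : ℂ}
    (hz : ∀ p ∈ C, a < dist z p) : ∀ᶠ y in 𝓝 z, ∀ p ∈ C, a < dist y p := by
  have hC : IsClosed C := isClosed_of_pairwise_le_dist (ε := d)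
    (by linarith [h.two_a_lt, h.a_pos]) fun p hp p' hp' hpp => h.sep p hp p' hp' hpp
  have hcl : IsClosed (⋃ p ∈ C, closedBall p a) := by
    rw [← hC.cthickening_eq_biUnion_closedBall h.a_pos.le]
    exact isClosed_cthickening
  filter_upwards [hcl.isOpen_compl.mem_nhds (by simpa using hz : z ∈ (⋃ p ∈ C, closedBall p a)ᶜ)]
    with y hy
  simpa using hy

lemma cases (z : ℂ) : (∃ p ∈ C, z ∈ ball p a) ∨ (∃ p ∈ C, z ∈ sphere p a) ∨
    ∀ p ∈ C, a < dist z p := by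
  by_cases h1 : ∃ p ∈ C, z ∈ ball p a
  · exact Or.inl h1
  by_cases h2 : ∃ p ∈ C, z ∈ sphere p a
  · exact Or.inr (Or.inl h2)
  refine Or.inr (Or.inr fun p hp => ?_)
  push Not at h1 h2
  exact lt_of_le_of_ne (by simpa using h1 p hp) (Ne.symm (h2 p hp))

lemma eq_or_eq (h : RealTransmission C a d k v F G) (z : ℂ) : v z = F z ∨ v z = G z := by
  by_cases h1 : ∃ p ∈ C, z ∈ ball p a
  · obtain ⟨p, hp, hz⟩ := h1
    exact Or.inl (h.eq_in p hp z hz)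
  · push Not at h1
    exact Or.inr (h.eq_ex z fun p hp => by simpa using h1 p hp)

lemma eq_in_closedBall (h : RealTransmission C a d k v F G) {p z : ℂ} (hp : p ∈ C)
    (hz : z ∈ closedBall p a) : v z = F z := by
  rcases (mem_closedBall.1 hz).lt_or_eq with hlt | heq
  · exact h.eq_in p hp z hlt
  · rw [h.continuity p hp z heq, h.eq_ex z fun p' hp' => h.le_dist_of_mem_sphere hp heq hp']

lemma continuous (h : RealTransmission C a d k v F G) : Continuous v := by
  refine continuous_iff_continuousAt.2 fun z => ?_
  rcases cases (C := C) (a := a) z with ⟨p, hp, hz⟩ | ⟨p, hp, hz⟩ | hz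
  · refine (h.harm_in p hp z hz).1.continuousAt.congr ?_
    filter_upwards [isOpen_ball.mem_nhds hz] with y hy using (h.eq_in p hp y hy).symm
  · have hF := (h.diff_in p hp z hz).continuousAt
    have hout := fun p' hp' => h.le_dist_of_mem_sphere (p' := p') hp hz hp'
    have hG := (h.diff_ex z hout).continuousAt
    rw [ContinuousAt, h.continuity p hp z hz, ← h.eq_ex z hout] at hF
    rw [ContinuousAt, ← h.eq_ex z hout] at hG
    refine fun s hs => mem_map.2 ?_
    filter_upwards [mem_map.1 (hF hs), mem_map.1 (hG hs)] with y h1 h2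
    rcases h.eq_or_eq y with hy | hy
    · rwa [mem_preimage, hy]
    · rwa [mem_preimage, hy]
  · obtain ⟨U, hU, hUo, hzU⟩ := _root_.eventually_nhds_iff.1 (h.eventually_outside hz)
    refine (h.harm_ex U hUo (fun y hy p hp => (hU y hy p hp).le) z hzU).1.continuousAt.congr ?_
    filter_upwards [hUo.mem_nhds hzU] with y hy
    exact (h.eq_ex y fun p hp => (hU y hy p hp).le).symm

lemma harmonicContOnCl_in (h : RealTransmission C a d k v F G) {p : ℂ} (hp : p ∈ C) :
    HarmonicContOnCl F (ball p a) :=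
  .mk_ball (h.harm_in p hp)
    (h.continuous.continuousOn.congr fun _ hz => (h.eq_in_closedBall hp hz).symm)

lemma harmonicContOnCl_ex (h : RealTransmission C a d k v F G) {c : ℂ} {R : ℝ}
    (hc : ∀ y ∈ closedBall c R, ∀ p ∈ C, a ≤ dist y p) : HarmonicContOnCl G (ball c R) :=
  .mk_ball (h.harm_ex _ isOpen_ball fun y hy => hc y (ball_subset_closedBall hy))
    (h.continuous.continuousOn.congr fun z hz => (h.eq_ex z (hc z hz)).symm)

lemma le_dist_of_mem_tangent_ball (h : RealTransmission C a d k v F G) {p q y p' : ℂ} {s : ℝ}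
    (hp : p ∈ C) (hq : q ∈ sphere p a) (hs : 0 < s) (hsd : 2 * s * a ≤ d - 2 * a)
    (hy : y ∈ closedBall (q + s • (q - p)) (s * a)) (hp' : p' ∈ C) : a ≤ dist y p' := by
  have hcp : dist (q + s • (q - p)) p = (1 + s) * a := by
    have : q + s • (q - p) - p = (1 + s) • (q - p) := by module
    rw [dist_eq_norm, this, norm_smul, Real.norm_of_nonneg (by linarith), ← dist_eq_norm,
      mem_sphere.1 hq]
  rw [mem_closedBall] at hy
  by_cases hpp : p = p'
  · subst hpp
    have := dist_triangle_left (q + s • (q - p)) p y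
    linarith
  · have := h.sep p hp p' hp' hpp
    have := dist_triangle_left p p' y
    have := dist_triangle y (q + s • (q - p)) p
    linarith

lemma max_on_circle (h : RealTransmission C a d k v F G) (hM : ∀ z, v z ≤ M) {p q : ℂ}
    (hp : p ∈ C) (hq : q ∈ sphere p a) (hqM : v q = M) :
    v p = M ∧ ∀ s : ℝ, 0 < s → 2 * s * a ≤ d - 2 * a → v (q + s • (q - p)) = M := by
  have hqF := h.eq_in_closedBall hp (sphere_subset_closedBall hq)
  have hout := fun p' hp' => h.le_dist_of_mem_sphere (p' := p') hp hq hp'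
  have hqG := h.eq_ex q hout
  have hin := hopf_boundary (h.harmonicContOnCl_in hp)
    (fun z hz => (h.eq_in_closedBall hp hz).symm.trans_le (hM z)) hq (hqF.symm.trans hqM) h.a_pos
    (h.diff_in p hp q hq)
  have hpF := h.eq_in_closedBall hp (mem_closedBall_self h.a_pos.le)
  have hflux := h.flux p hp q hq
  have hex : ∀ s : ℝ, 0 < s → 2 * s * a ≤ d - 2 * a →
      (M - v (q + s • (q - p))) / 2 ≤ - (s * fderiv ℝ G q (q - p)) := by
    intro s hs hsd
    have hb := fun y hy p' hp' =>
      h.le_dist_of_mem_tangent_ball (y := y) (p' := p') hp hq hs hsd hy hp'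
    have hsa : 0 < s * a := mul_pos hs h.a_pos
    have hqs : q ∈ sphere (q + s • (q - p)) (s * a) := by
      rw [mem_sphere, dist_self_add_right, norm_smul, Real.norm_of_nonneg hs.le, ← dist_eq_norm,
        mem_sphere.1 hq]
    have := hopf_boundary (h.harmonicContOnCl_ex hb)
      (fun z hz => (h.eq_ex z (hb z hz)).symm.trans_le (hM z)) hqs (hqG.symm.trans hqM) hsa
      (h.diff_ex q hout)
    rw [sub_add_cancel_left, map_neg, map_smul, smul_eq_mul] at this
    rwa [h.eq_ex _ (hb _ (mem_closedBall_self hsa.le))]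
  have hFnonneg : 0 ≤ fderiv ℝ F q (q - p) := by linarith [hM p]
  have hGnonneg : 0 ≤ fderiv ℝ G q (q - p) := hflux ▸ mul_nonneg h.k_pos.le hFnonneg
  have hG0 : fderiv ℝ G q (q - p) = 0 := by
    have hs0 : 0 < (d - 2 * a) / (2 * a) :=
      div_pos (by linarith [h.two_a_lt]) (by linarith [h.a_pos])
    have hs1 : 2 * ((d - 2 * a) / (2 * a)) * a = d - 2 * a := by
      have := h.a_pos.ne'
      field_simp
    have := hex _ hs0 hs1.le
    have := hM (q + ((d - 2 * a) / (2 * a)) • (q - p))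
    nlinarith
  have hF0 : fderiv ℝ F q (q - p) = 0 := by
    rw [hG0] at hflux
    exact (mul_eq_zero.1 hflux).resolve_left h.k_pos.ne'
  refine ⟨by linarith [hM p], fun s hs hsd => ?_⟩
  have := hex s hs hsd
  rw [hG0] at this
  linarith [hM (q + s • (q - p))]

/-- A real transmission solution attaining its maximum is constant. -/
theorem eq_max (h : RealTransmission C a d k v F G) {z₀ : ℂ} (hM : ∀ z, v z ≤ v z₀) (z : ℂ) :
    v z = v z₀ := by
  have hclosed : IsClosed {z | v z = v z₀} := isClosed_eq h.continuous continuous_const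
  suffices hopen : IsOpen {z | v z = v z₀} by
    have := IsClopen.eq_univ ⟨hclosed, hopen⟩ ⟨z₀, rfl⟩
    exact this.ge (mem_univ z)
  refine isOpen_iff_mem_nhds.2 fun q hq => ?_
  have hin : ∀ p ∈ C, v p = v z₀ → ball p a ⊆ {z | v z = v z₀} := fun p hp hpM z hz => by
    have hpF := h.eq_in_closedBall hp (mem_closedBall_self h.a_pos.le)
    exact (h.eq_in p hp z hz).trans <| eq_of_max_at_center (h.harmonicContOnCl_in hp)
      (fun z hz => (h.eq_in_closedBall hp hz).symm.trans_le (hM z)) (hpF.symm.trans hpM) hz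
  rcases cases (C := C) (a := a) q with ⟨p, hp, hz⟩ | ⟨p, hp, hz⟩ | hz
  · obtain ⟨r, hr, hrs⟩ := nhds_basis_closedBall.mem_iff.1 (isOpen_ball.mem_nhds hz)
    refine mem_of_superset (ball_mem_nhds q hr) fun y hy => ?_
    have heq := fun x hx => h.eq_in p hp x (hrs hx)
    exact (heq y (ball_subset_closedBall hy)).trans <| eq_of_max_at_center
      ((h.harmonicContOnCl_in hp).mono (ball_subset_closedBall.trans hrs))
      (fun x hx => (heq x hx).symm.trans_le (hM x))
      ((heq q (mem_closedBall_self hr.le)).symm.trans hq) hy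
  · have hball := hin p hp (h.max_on_circle hM hp hz hq).1
    have hcball : closedBall p a ⊆ {z | v z = v z₀} := by
      rw [← closure_ball p h.a_pos.ne']
      exact hclosed.closure_subset_iff.2 hball
    have hd := h.two_a_lt
    have hqb : q ∈ ball p (a + (d - 2 * a) / 2) := by
      rw [mem_ball, mem_sphere.1 hz]
      linarith
    refine mem_of_superset (isOpen_ball.mem_nhds hqb) fun y hy => ?_
    by_cases hya : y ∈ closedBall p a
    · exact hcball hya
    rw [mem_closedBall, not_le, dist_eq_norm] at hya
    rw [mem_ball, dist_eq_norm] at hy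
    have ha := h.a_pos
    have hn : 0 < ‖y - p‖ := ha.trans hya
    have hq' : p + (a / ‖y - p‖) • (y - p) ∈ sphere p a := by
      rw [mem_sphere, dist_self_add_left, norm_smul, Real.norm_of_nonneg (by positivity)]
      field_simp
    have := (h.max_on_circle hM hp hq' (hcball (sphere_subset_closedBall hq'))).2
      (‖y - p‖ / a - 1) (by rw [sub_pos, lt_div_iff₀ ha]; linarith)
      (by
        have : 2 * (‖y - p‖ / a - 1) * a = 2 * (‖y - p‖ - a) := by field_simp
        linarith)
    have hy' : p + (a / ‖y - p‖) • (y - p) +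
        (‖y - p‖ / a - 1) • (p + (a / ‖y - p‖) • (y - p) - p) = y := by
      rw [add_sub_cancel_left, smul_smul, add_assoc, ← add_smul]
      have : a / ‖y - p‖ + (‖y - p‖ / a - 1) * (a / ‖y - p‖) = 1 := by
        field_simp
        ring
      rw [this, one_smul, add_sub_cancel]
    rwa [hy'] at this
  · obtain ⟨r, hr, hrs⟩ := nhds_basis_closedBall.mem_iff.1 (h.eventually_outside hz)
    refine mem_of_superset (ball_mem_nhds q hr) fun y hy => ?_
    have hout : ∀ x ∈ closedBall q r, ∀ p ∈ C, a ≤ dist x p := fun x hx p hp => (hrs hx p hp).le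
    have heq := fun x hx => h.eq_ex x (hout x hx)
    exact (heq y (ball_subset_closedBall hy)).trans <| eq_of_max_at_center
      (h.harmonicContOnCl_ex hout) (fun x hx => (heq x hx).symm.trans_le (hM x))
      ((heq q (mem_closedBall_self hr.le)).symm.trans hq) hy

end RealTransmission

lemma lap_eq_laplacian {f : ℝ × ℝ → ℂ} {z : ℂ} (hf : ContDiffAt ℝ 2 f (z.re, z.im)) :
    Laplacian.laplacian (f ∘ Complex.equivRealProdCLM) z = lap f (z.re, z.im) := by
  have hdd : DifferentiableAt ℝ (fderiv ℝ (f ∘ Complex.equivRealProdCLM)) z :=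
    ((hf.comp (f := Complex.equivRealProdCLM) z
      Complex.equivRealProdCLM.contDiff.contDiffAt).fderiv_right
      (m := 1) (by norm_num)).differentiableAt one_ne_zero
  have key : ∀ w : ℂ, fderiv ℝ (fderiv ℝ (f ∘ Complex.equivRealProdCLM)) z w w =
      fderiv ℝ (fun p => fderiv ℝ f p (w.re, w.im)) (z.re, z.im) (w.re, w.im) := by
    intro w
    have h1 : fderiv ℝ (fderiv ℝ (f ∘ Complex.equivRealProdCLM)) z w w =
        fderiv ℝ (fun y => fderiv ℝ (f ∘ Complex.equivRealProdCLM) y w) z w := by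
      rw [fderiv_clm_apply hdd (differentiableAt_const w)]
      simp
    have h2 : (fun y => fderiv ℝ (f ∘ Complex.equivRealProdCLM) y w) =
        (fun p => fderiv ℝ f p (w.re, w.im)) ∘ Complex.equivRealProdCLM := by
      ext y
      rw [ContinuousLinearEquiv.comp_right_fderiv]
      simp
    rw [h1, h2, ContinuousLinearEquiv.comp_right_fderiv]
    simp
  rw [laplacian_eq_iteratedFDeriv_complexPlane]
  simp [iteratedFDeriv_two_apply, key, lap]

lemma harmonicOnNhd_comp {f : ℝ × ℝ → ℂ} {U : Set ℂ} (hU : IsOpen U) (L : ℂ →L[ℝ] ℝ)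
    (hf : ∀ z ∈ U, ContDiffAt ℝ 2 f (z.re, z.im)) (hlap : ∀ z ∈ U, lap f (z.re, z.im) = 0) :
    HarmonicOnNhd (L ∘ f ∘ Complex.equivRealProdCLM) U := by
  intro z hz
  refine HarmonicAt.comp_CLM ⟨(hf z hz).comp (f := Complex.equivRealProdCLM) z
    Complex.equivRealProdCLM.contDiff.contDiffAt, ?_⟩ L
  filter_upwards [hU.mem_nhds hz] with y hy
  rw [lap_eq_laplacian (hf y hy), hlap y hy, Pi.zero_apply]

lemma sq_dist_eq (z w : ℂ) : (z.re - w.re) ^ 2 + (z.im - w.im) ^ 2 = dist z w ^ 2 := by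
  rw [Complex.dist_eq_re_im, Real.sq_sqrt (by positivity)]

lemma mem_disks_iff {τ₁ τ₂ a : ℝ} (ha : 0 < a) (z : ℂ) : (z.re, z.im) ∈ disks τ₁ τ₂ a ↔
    ∃ p ∈ Complex.equivRealProdCLM ⁻¹' centers τ₁ τ₂, z ∈ ball p a := by
  have hiff : ∀ p : ℂ, (z.re - p.re) ^ 2 + (z.im - p.im) ^ 2 < a ^ 2 ↔ z ∈ ball p a := fun p => by
    rw [sq_dist_eq, mem_ball, sq_lt_sq₀ dist_nonneg ha.le]
  constructor
  · rintro ⟨p, hp, hlt⟩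
    exact ⟨⟨p.1, p.2⟩, by simpa using hp, (hiff ⟨p.1, p.2⟩).1 hlt⟩
  · rintro ⟨p, hp, hlt⟩
    exact ⟨(p.re, p.im), by simpa using hp, (hiff p).2 hlt⟩

lemma centers_separated {τ₁ τ₂ : ℝ} (hτ₁ : 0 < τ₁) (hτ₂ : 0 < τ₂) {p p' : ℂ}
    (hp : (p.re, p.im) ∈ centers τ₁ τ₂) (hp' : (p'.re, p'.im) ∈ centers τ₁ τ₂) (hne : p ≠ p') :
    min τ₁ τ₂ ≤ dist p p' := by
  obtain ⟨m, n, h⟩ := hp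
  obtain ⟨m', n', h'⟩ := hp'
  simp only [Prod.mk.injEq] at h h'
  have hint : ∀ (i j : ℤ) (τ : ℝ), 0 < τ → i ≠ j → τ ≤ |i * τ - j * τ| := by
    intro i j τ hτ hij
    rw [← sub_mul, abs_mul, abs_of_pos hτ]
    have : (1 : ℝ) ≤ |(i : ℝ) - j| := by
      exact_mod_cast Int.one_le_abs (sub_ne_zero.2 hij)
    nlinarith
  rw [dist_eq_norm]
  by_cases hm : m = m'
  · have hn : n ≠ n' := by
      rintro rfl
      subst hm
      exact hne (Complex.ext (h.1.trans h'.1.symm) (h.2.trans h'.2.symm))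
    refine (min_le_right _ _).trans ((hint n n' τ₂ hτ₂ hn).trans ?_)
    simpa [h.2, h'.2] using Complex.abs_im_le_norm (p - p')
  · refine (min_le_left _ _).trans ((hint m m' τ₁ hτ₁ hm).trans ?_)
    simpa [h.1, h'.1] using Complex.abs_re_le_norm (p - p')

/-- A continuous doubly periodic real function attains its maximum. -/
lemma exists_max_of_periodic {τ₁ τ₂ : ℝ} (hτ₁ : 0 < τ₁) (hτ₂ : 0 < τ₂) {v : ℂ → ℝ}
    (hv : Continuous v) (h₁ : Function.Periodic v (τ₁ : ℂ))
    (h₂ : Function.Periodic v (τ₂ * Complex.I)) : ∃ z₀, ∀ z, v z ≤ v z₀ := by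
  obtain ⟨z₀, -, hz₀⟩ := (isCompact_Icc.reProdIm isCompact_Icc).exists_isMaxOn
    (⟨0, by simp [Complex.mem_reProdIm, hτ₁.le, hτ₂.le]⟩ :
      (Icc 0 τ₁ ×ℂ Icc 0 τ₂).Nonempty) hv.continuousOn
  refine ⟨z₀, fun z => ?_⟩
  have hz : v (z - ⌊z.re / τ₁⌋ • (τ₁ : ℂ) - ⌊z.im / τ₂⌋ • (τ₂ * Complex.I)) = v z := by
    rw [h₂.sub_zsmul_eq, h₁.sub_zsmul_eq]
  rw [← hz]
  have hfl : ∀ (x τ : ℝ), 0 < τ → ⌊x / τ⌋ * τ ≤ x ∧ x ≤ τ + ⌊x / τ⌋ * τ := by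
    intro x τ hτ
    have h1 := Int.floor_le (x / τ)
    have h2 := (Int.lt_floor_add_one (x / τ)).le
    rw [le_div_iff₀ hτ] at h1
    rw [div_le_iff₀ hτ] at h2
    exact ⟨h1, by linarith⟩
  refine hz₀ ?_
  simpa [Complex.mem_reProdIm] using And.intro (hfl z.re τ₁ hτ₁) (hfl z.im τ₂ hτ₂)

lemma IsTransmission.realTransmission {τ₁ τ₂ a ε : ℝ} (hτ₁ : 0 < τ₁) (hτ₂ : 0 < τ₂) (ha : 0 < a)
    (ha' : a < min τ₁ τ₂ / 2) (hε : 0 < ε) {u Uin Uex : ℝ × ℝ → ℂ}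
    (h : IsTransmission τ₁ τ₂ a ε u Uin Uex)
    (hharm_in : ∀ r ∈ disks τ₁ τ₂ a, lap Uin r = 0)
    (hharm_ex : ∀ r ∈ (closure (disks τ₁ τ₂ a))ᶜ, lap Uex r = 0) (L : ℂ →L[ℝ] ℝ) :
    RealTransmission (Complex.equivRealProdCLM ⁻¹' centers τ₁ τ₂) a (min τ₁ τ₂) (1 / ε)
      (L ∘ u ∘ Complex.equivRealProdCLM) (L ∘ Uin ∘ Complex.equivRealProdCLM)
      (L ∘ Uex ∘ Complex.equivRealProdCLM) := by
  obtain ⟨Nin, hNin, hsub_in, hsm_in⟩ := h.smooth_in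
  obtain ⟨Nex, hNex, hsub_ex, hsm_ex⟩ := h.smooth_ex
  have hsep : ∀ p ∈ Complex.equivRealProdCLM ⁻¹' centers τ₁ τ₂,
      ∀ p' ∈ Complex.equivRealProdCLM ⁻¹' centers τ₁ τ₂, p ≠ p' → min τ₁ τ₂ ≤ dist p p' :=
    fun p hp p' hp' hne =>
      centers_separated hτ₁ hτ₂ (by simpa using hp) (by simpa using hp') hne
  have hcont : Continuous fun z : ℂ => (z.re, z.im) := Complex.equivRealProdCLM.continuous
  have hball : ∀ p ∈ Complex.equivRealProdCLM ⁻¹' centers τ₁ τ₂, ∀ z ∈ ball p a,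
      (z.re, z.im) ∈ disks τ₁ τ₂ a := fun p hp z hz => (mem_disks_iff ha z).2 ⟨p, hp, hz⟩
  have hcball : ∀ p ∈ Complex.equivRealProdCLM ⁻¹' centers τ₁ τ₂, ∀ z ∈ closedBall p a,
      ContDiffAt ℝ 2 Uin (z.re, z.im) := by
    intro p hp z hz
    refine hsm_in.contDiffAt (hNin.mem_nhds (hsub_in ?_))
    rw [← closure_ball p ha.ne'] at hz
    exact map_mem_closure (f := fun z : ℂ => (z.re, z.im)) hcont hz (hball p hp)
  have hout : ∀ z : ℂ, (∀ p ∈ Complex.equivRealProdCLM ⁻¹' centers τ₁ τ₂, a ≤ dist z p) →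
      (z.re, z.im) ∉ disks τ₁ τ₂ a := by
    intro z hz hmem
    obtain ⟨p, hp, hlt⟩ := (mem_disks_iff ha z).1 hmem
    exact (hz p hp).not_gt hlt
  have hex : ∀ z : ℂ, (∀ p ∈ Complex.equivRealProdCLM ⁻¹' centers τ₁ τ₂, a ≤ dist z p) →
      ContDiffAt ℝ 2 Uex (z.re, z.im) := fun z hz =>
    hsm_ex.contDiffAt (hNex.mem_nhds (hsub_ex (hout z hz)))
  have hsphere : ∀ p q : ℂ, q ∈ sphere p a → (q.re - p.re) ^ 2 + (q.im - p.im) ^ 2 = a ^ 2 :=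
    fun p q hq => by rw [sq_dist_eq, mem_sphere.1 hq]
  have hfderiv : ∀ (f : ℝ × ℝ → ℂ) (z : ℂ), ContDiffAt ℝ 2 f (z.re, z.im) →
      HasFDerivAt (L ∘ f ∘ Complex.equivRealProdCLM)
        (L ∘L fderiv ℝ f (z.re, z.im) ∘L Complex.equivRealProdCLM.toContinuousLinearMap) z := by
    intro f z hf
    exact L.hasFDerivAt.comp z ((hf.differentiableAt two_ne_zero).hasFDerivAt.comp
      (f := Complex.equivRealProdCLM) z Complex.equivRealProdCLM.hasFDerivAt)
  have hsphere_out : ∀ p ∈ Complex.equivRealProdCLM ⁻¹' centers τ₁ τ₂, ∀ q ∈ sphere p a,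
      ∀ p' ∈ Complex.equivRealProdCLM ⁻¹' centers τ₁ τ₂, a ≤ dist q p' := by
    intro p hp q hq p' hp'
    rw [mem_sphere] at hq
    by_cases hpp : p = p'
    · exact hpp ▸ hq.ge
    · have := hsep p hp p' hp' hpp
      have := dist_triangle_left p p' q
      linarith
  refine
    { a_pos := ha
      k_pos := by positivity
      two_a_lt := by linarith
      sep := hsep
      harm_in := fun p hp => harmonicOnNhd_comp isOpen_ball L
        (fun z hz => hcball p hp z (ball_subset_closedBall hz))
        (fun z hz => hharm_in _ (hball p hp z hz))
      harm_ex := fun U hU hUa => harmonicOnNhd_comp hU L (fun z hz => hex z (hUa z hz))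
        (fun z hz => hharm_ex _ fun hcl => ?_)
      diff_in := fun p hp q hq =>
        (hfderiv Uin q (hcball p hp q (sphere_subset_closedBall hq))).differentiableAt
      diff_ex := fun q hq => (hfderiv Uex q (hex q hq)).differentiableAt
      eq_in := fun p hp z hz => congrArg L (h.eq_in _ (hball p hp z hz))
      eq_ex := fun z hz => congrArg L (h.eq_ex _ (hout z hz))
      continuity := fun p hp q hq => congrArg L
        (h.continuity (p.re, p.im) (by simpa using hp) (q.re, q.im) (hsphere p q hq))
      flux := fun p hp q hq => ?_ }
  · have hopen : IsOpen ((fun r : ℝ × ℝ => (⟨r.1, r.2⟩ : ℂ)) ⁻¹' U) :=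
      hU.preimage Complex.equivRealProdCLM.symm.continuous
    obtain ⟨⟨x, y⟩, hxU, hxd⟩ := mem_closure_iff.1 hcl _ hopen hz
    exact hout ⟨x, y⟩ (hUa ⟨x, y⟩ hxU) hxd
  · rw [(hfderiv Uin q (hcball p hp q (sphere_subset_closedBall hq))).fderiv,
      (hfderiv Uex q (hex q (hsphere_out p hp q hq))).fderiv]
    have := congrArg L
      (h.flux (p.re, p.im) (by simpa using hp) (q.re, q.im) (hsphere p q hq))
    have hcast : (1 / ε : ℂ) * fderiv ℝ Uin (q.re, q.im) (q.re - p.re, q.im - p.im) =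
        (1 / ε : ℝ) • fderiv ℝ Uin (q.re, q.im) (q.re - p.re, q.im - p.im) := by
      rw [Complex.real_smul]
      push_cast
      rfl
    rw [hcast, map_smul, smul_eq_mul] at this
    simpa using this

lemma IsTransmission.exists_comp_eq_const {τ₁ τ₂ a ε : ℝ} (hτ₁ : 0 < τ₁) (hτ₂ : 0 < τ₂) (ha : 0 < a)
    (ha' : a < min τ₁ τ₂ / 2) (hε : 0 < ε) {u Uin Uex : ℝ × ℝ → ℂ}
    (h : IsTransmission τ₁ τ₂ a ε u Uin Uex)
    (hper₁ : ∀ r : ℝ × ℝ, u (r.1 + τ₁, r.2) = u r) (hper₂ : ∀ r : ℝ × ℝ, u (r.1, r.2 + τ₂) = u r)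
    (hharm_in : ∀ r ∈ disks τ₁ τ₂ a, lap Uin r = 0)
    (hharm_ex : ∀ r ∈ (closure (disks τ₁ τ₂ a))ᶜ, lap Uex r = 0) (L : ℂ →L[ℝ] ℝ) :
    ∃ c : ℝ, ∀ r, L (u r) = c := by
  have hT := h.realTransmission hτ₁ hτ₂ ha ha' hε hharm_in hharm_ex L
  obtain ⟨z₀, hz₀⟩ := exists_max_of_periodic hτ₁ hτ₂ hT.continuous
    (fun z => by simpa using congrArg L (hper₁ (z.re, z.im)))
    (fun z => by simpa using congrArg L (hper₂ (z.re, z.im)))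
  exact ⟨_, fun r => hT.eq_max hz₀ ⟨r.1, r.2⟩⟩

/-- A doubly periodic transmission function that is harmonic off the circles is
constant. -/
theorem periodic_harmonic_transmission_constant (τ₁ τ₂ a ε : ℝ)
    (hτ₁ : 0 < τ₁) (hτ₂ : 0 < τ₂) (ha : 0 < a) (ha' : a < min τ₁ τ₂ / 2)
    (hε : 0 < ε) (u Uin Uex : ℝ × ℝ → ℂ)
    (htrans : IsTransmission τ₁ τ₂ a ε u Uin Uex)
    (hper₁ : ∀ r : ℝ × ℝ, u (r.1 + τ₁, r.2) = u r)
    (hper₂ : ∀ r : ℝ × ℝ, u (r.1, r.2 + τ₂) = u r)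
    (hharm_in : ∀ r ∈ disks τ₁ τ₂ a, lap Uin r = 0)
    (hharm_ex : ∀ r ∈ (closure (disks τ₁ τ₂ a))ᶜ, lap Uex r = 0) :
    ∃ c : ℂ, ∀ r : ℝ × ℝ, u r = c := by
  obtain ⟨x, hx⟩ := htrans.exists_comp_eq_const hτ₁ hτ₂ ha ha' hε hper₁ hper₂ hharm_in hharm_ex
    Complex.reCLM
  obtain ⟨y, hy⟩ := htrans.exists_comp_eq_const hτ₁ hτ₂ ha ha' hε hper₁ hper₂ hharm_in hharm_ex
    Complex.imCLM
  exact ⟨⟨x, y⟩, fun r => Complex.ext (hx r) (hy r)⟩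
end
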